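/- arXiv:2604.13802 — 4 statements merged into one kernel-verified Lean document; each statement's English description precedes it below -/
import Mathlib

section
/- Let (X, λ) be a standard Borel space with an atomless σ-finite measure satisfying λ(X) = ∞, let T ∈ Aut(X, λ) be conservative and aperiodic, and let B ⊆ X be a Borel set with λ(B) < ∞ intersecting the T-orbit of λ-a.e. point of X. Fix an integer n ≥ 1 and a sequence of real numbers (λ_k)_{k ≥ n} with λ_k > λ(τ_{B,T}⁻¹(k)) for all k ≥ n. Then there exists a Borel set C ⊆ X disjoint from B such that: (i) for all k < n, τ_{B∪C,T}⁻¹(k) = τ_{B,T}⁻¹(k) (up to a λ-null set); (ii) λ(τ_{B∪C,T}⁻¹(n)) = λ_n; (iii) for all k > n, λ(τ_{B∪C,T}⁻¹(k)) < λ_k. -/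
open MeasureTheory Set
open scoped ENNReal

variable {X : Type*}

/-- `T` is aperiodic: almost every point has `T^[n] x ≠ x` for all `n ≥ 1`. -/
def Aperiodic [MeasurableSpace X] (lam : Measure X) (T : X ≃ᵐ X) : Prop :=
  ∀ᵐ x ∂lam, ∀ n : ℕ, 1 ≤ n → (⇑T)^[n] x ≠ x

/-- `T` is conservative. -/
def Conserv [MeasurableSpace X] (lam : Measure X) (T : X ≃ᵐ X) : Prop :=
  ∀ A : Set X, MeasurableSet A → 0 < lam A →
    ∀ᵐ x ∂lam, x ∈ A → ∃ n : ℕ, 1 ≤ n ∧ (⇑T)^[n] x ∈ A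

/-- `retLevel T B k` is `τ_{B,T}⁻¹(k)`, the set of points of `B` whose first return time
to `B` under `T` equals `k`. -/
def retLevel [MeasurableSpace X] (T : X ≃ᵐ X) (B : Set X) (k : ℕ) : Set X :=
  {x | x ∈ B ∧ (⇑T)^[k] x ∈ B ∧ ∀ m : ℕ, 1 ≤ m → m < k → (⇑T)^[m] x ∉ B}

theorem rte_exists_measure_eq_real (μ : Measure ℝ) [IsFiniteMeasure μ] [NullSingletonClass μ]
    (e : ℝ≥0∞) (he : e < μ univ) : ∃ A, MeasurableSet A ∧ μ A = e := by
  have hU : (⋃ m : ℕ, Ioc (-(m : ℝ)) m) = univ := by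
    ext x
    simp only [mem_iUnion, mem_Ioc, mem_univ, iff_true]
    obtain ⟨m, hm⟩ := exists_nat_gt |x|
    exact ⟨m, by linarith [neg_abs_le x], by linarith [le_abs_self x]⟩
  have hmono : Monotone (fun m : ℕ => Ioc (-(m : ℝ)) m) := by
    intro a b hab
    have : (a : ℝ) ≤ b := by exact_mod_cast hab
    exact Ioc_subset_Ioc (by linarith) this
  have ht := tendsto_measure_iUnion_atTop (μ := μ) hmono
  rw [hU] at ht
  obtain ⟨m, hm⟩ := (ht.eventually (lt_mem_nhds he)).exists
  simp only [Function.comp] at hm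
  have hcont : Continuous (fun t => ∫ _ in (-(m : ℝ))..t, (1 : ℝ) ∂μ) :=
    intervalIntegral.continuous_primitive (fun a b => by simp) _
  have hle : (-(m : ℝ)) ≤ m := by linarith [Nat.cast_nonneg (α := ℝ) m]
  have key : ∀ t, (-(m : ℝ)) ≤ t → (∫ _ in (-(m : ℝ))..t, (1 : ℝ) ∂μ) = μ.real (Ioc (-(m : ℝ)) t) := by
    intro t ht
    rw [intervalIntegral.integral_of_le ht]
    simp
  have hetop : e ≠ ∞ := (he.trans_le le_top).ne
  have hmem : e.toReal ∈ Icc (∫ _ in (-(m : ℝ))..(-(m : ℝ)), (1 : ℝ) ∂μ)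
      (∫ _ in (-(m : ℝ))..(m : ℝ), (1 : ℝ) ∂μ) := by
    refine ⟨by simp, ?_⟩
    rw [key _ hle]
    exact ENNReal.toReal_mono (measure_ne_top _ _) hm.le
  obtain ⟨t, ht1, ht2⟩ := intermediate_value_Icc hle hcont.continuousOn hmem
  refine ⟨Ioc (-(m : ℝ)) t, measurableSet_Ioc, ?_⟩
  simp only at ht2
  rw [key t ht1.1] at ht2
  exact (ENNReal.toReal_eq_toReal_iff' (measure_ne_top _ _) hetop).1 ht2

theorem rte_exists_measure_eq [MeasurableSpace X] [StandardBorelSpace X] (μ : Measure X)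
    [IsFiniteMeasure μ] (h0 : ∀ x, μ {x} = 0)
    (e : ℝ≥0∞) (he : e < μ univ) : ∃ A, MeasurableSet A ∧ μ A = e := by
  obtain ⟨f, hf⟩ := exists_measurableEmbedding_real X
  have : NullSingletonClass (μ.map f) := by
    constructor
    intro y
    rw [Measure.map_apply hf.measurable (measurableSet_singleton y)]
    have : (f ⁻¹' {y}).Subsingleton := by
      intro a ha b hb
      exact hf.injective (ha.trans hb.symm)
    rcases this.eq_empty_or_singleton with h | ⟨x, h⟩
    · simp [h]
    · rw [h]; exact h0 x
  obtain ⟨A, hA, hAe⟩ := rte_exists_measure_eq_real (μ.map f) e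
    (by rwa [Measure.map_apply hf.measurable MeasurableSet.univ, preimage_univ])
  exact ⟨f ⁻¹' A, hf.measurable hA, by rwa [Measure.map_apply hf.measurable hA] at hAe⟩

section
variable [MeasurableSpace X]

theorem rte_tower (T : X ≃ᵐ X) {B : Set X} {a b : X} {u v : ℕ} (ha : a ∈ B) (hb : b ∈ B)
    (hu : ∀ j, 1 ≤ j → j ≤ u → (⇑T)^[j] a ∉ B) (hv : ∀ j, 1 ≤ j → j ≤ v → (⇑T)^[j] b ∉ B)
    (h : (⇑T)^[u] a = (⇑T)^[v] b) : u = v ∧ a = b := by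
  have main : ∀ {a b : X} {u v : ℕ}, a ∈ B → (∀ j, 1 ≤ j → j ≤ v → (⇑T)^[j] b ∉ B) →
      (⇑T)^[u] a = (⇑T)^[v] b → u ≤ v → u = v ∧ a = b := by
    intro a b u v ha hv h huv
    obtain ⟨w, rfl⟩ := Nat.exists_eq_add_of_le huv
    rw [Function.iterate_add_apply] at h
    have h := T.injective.iterate u h
    rcases Nat.eq_zero_or_pos w with rfl | hw
    · exact ⟨rfl, h⟩
    · exact absurd (h ▸ ha) (hv w hw (by omega))
  rcases le_total u v with huv | huv
  · exact main ha hv h huv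
  · obtain ⟨h1, h2⟩ := main hb hu h.symm huv
    exact ⟨h1.symm, h2.symm⟩

theorem rte_unique {T : X ≃ᵐ X} {B : Set X} {x : X} {p q : ℕ} (hp : 1 ≤ p) (hq : 1 ≤ q)
    (h1 : x ∈ retLevel T B p) (h2 : x ∈ retLevel T B q) : p = q := by
  rcases lt_trichotomy p q with h | h | h
  · exact absurd h1.2.1 (h2.2.2 p hp h)
  · exact h
  · exact absurd h2.2.1 (h1.2.2 q hq h)

theorem rte_meas {T : X ≃ᵐ X} {B : Set X} (hB : MeasurableSet B) (k : ℕ) :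
    MeasurableSet (retLevel T B k) := by
  have hm : ∀ m, Measurable ((⇑T)^[m]) := fun m => T.measurable.iterate m
  have : retLevel T B k = B ∩ ((⇑T)^[k] ⁻¹' B ∩
      ⋂ m : ℕ, ⋂ _ : 1 ≤ m, ⋂ _ : m < k, ((⇑T)^[m] ⁻¹' B)ᶜ) := by
    ext x
    simp only [retLevel, mem_setOf_eq, mem_inter_iff, mem_iInter, mem_compl_iff, mem_preimage]
  rw [this]
  refine hB.inter ((hm k hB).inter ?_)
  exact MeasurableSet.iInter fun m => MeasurableSet.iInter fun _ => MeasurableSet.iInter fun _ =>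
    (hm m hB).compl

theorem rte_image [StandardBorelSpace X] {lam : Measure X} {T : X ≃ᵐ X}
    (hT : MeasurePreserving (⇑T) lam lam) (m : ℕ) {s : Set X} (hs : MeasurableSet s) :
    MeasurableSet ((⇑T)^[m] '' s) ∧ lam ((⇑T)^[m] '' s) = lam s := by
  have hinj := T.injective.iterate m
  have h1 : MeasurableSet ((⇑T)^[m] '' s) :=
    ((T.measurable.iterate m).measurableEmbedding hinj).measurableSet_image' hs
  refine ⟨h1, ?_⟩
  have := (hT.iterate m).measure_preimage h1.nullMeasurableSet
  rwa [preimage_image_eq _ hinj, eq_comm] at this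

/-- the inserted set -/
def rteC (T : X ≃ᵐ X) (S : Finset ℕ) (n : ℕ) (A : ℕ → Set X) : Set X :=
  ⋃ N ∈ S, ⋃ i ∈ Finset.Ico 1 (N / n), (⇑T)^[i * n] '' (A N)

/-- number of new points of level n in a column -/
def rteg (n N : ℕ) : ℕ := if n ∣ N then N / n else N / n - 1

theorem rteg_iff {n N i : ℕ} (hn : 1 ≤ n) :
    i < rteg n N ↔ (i * n + 2 * n ≤ N ∨ i * n + n = N) := by
  unfold rteg
  split_ifs with h
  · obtain ⟨q, rfl⟩ := h
    rw [Nat.mul_div_cancel_left _ hn]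
    constructor
    · intro hi
      rcases Nat.lt_or_ge (i + 1) q with h | h
      · left; nlinarith
      · right
        have : q = i + 1 := by omega
        subst this; ring
    · rintro (h | h)
      · have : n * (i + 2) ≤ n * q := by linarith
        have := Nat.le_of_mul_le_mul_left this hn
        omega
      · have : n * (i + 1) = n * q := by linarith
        have := Nat.eq_of_mul_eq_mul_left hn this
        omega
  · have h1 : i < N / n - 1 ↔ i + 2 ≤ N / n := by omega
    rw [h1, Nat.le_div_iff_mul_le hn]
    constructor
    · intro h; left; linarith
    · rintro (h' | h')
      · linarith
      · exact absurd ⟨i + 1, by rw [← h']; ring⟩ h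

/-- new level set -/
def rteD (T : X ≃ᵐ X) (S : Finset ℕ) (n : ℕ) (A : ℕ → Set X) : Set X :=
  ⋃ p ∈ S.sigma (fun N => Finset.range (rteg n N)), (⇑T)^[p.2 * n] '' (A p.1)

theorem rte_memC {T : X ≃ᵐ X} {S : Finset ℕ} {n : ℕ} (hn : 1 ≤ n) {A : ℕ → Set X} {x : X} :
    x ∈ rteC T S n A ↔ ∃ N ∈ S, ∃ i, 1 ≤ i ∧ i * n + n ≤ N ∧ ∃ a ∈ A N, (⇑T)^[i * n] a = x := by
  have : ∀ i N, i < N / n ↔ i * n + n ≤ N := by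
    intro i N
    rw [Nat.lt_iff_add_one_le, Nat.le_div_iff_mul_le hn, Nat.add_mul, one_mul]
  simp only [rteC, mem_iUnion, Finset.mem_Ico, this, mem_image, exists_prop, and_assoc]

theorem rte_memD {T : X ≃ᵐ X} {S : Finset ℕ} {n : ℕ} (hn : 1 ≤ n) {A : ℕ → Set X} {x : X} :
    x ∈ rteD T S n A ↔ ∃ N ∈ S, ∃ i, (i * n + 2 * n ≤ N ∨ i * n + n = N) ∧
      ∃ a ∈ A N, (⇑T)^[i * n] a = x := by
  simp only [rteD, mem_iUnion, Finset.mem_sigma, Finset.mem_range, rteg_iff hn, mem_image,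
    exists_prop, Sigma.exists, and_assoc, exists_and_left]

variable {T : X ≃ᵐ X} {S : Finset ℕ} {n : ℕ} {A : ℕ → Set X} {B : Set X}

theorem rte_disj (hn : 1 ≤ n) (hA : ∀ N, A N ⊆ retLevel T B N) {x : X}
    (hx : x ∈ rteC T S n A) : x ∉ B := by
  obtain ⟨N, hN, i, hi, hiN, a, ha, rfl⟩ := (rte_memC hn).1 hx
  exact (hA N ha).2.2 _ (by nlinarith) (by omega)

theorem rte_key (hn : 1 ≤ n) (hA : ∀ N, A N ⊆ retLevel T B N) {b : X} {m : ℕ} (hb : b ∈ B)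
    (hm : ∀ j, 1 ≤ j → j < m → (⇑T)^[j] b ∉ B) (h : (⇑T)^[m] b ∈ rteC T S n A) :
    ∃ N ∈ S, ∃ i, 1 ≤ i ∧ i * n + n ≤ N ∧ b ∈ A N ∧ m = i * n := by
  have hd := rte_disj hn hA h
  obtain ⟨N, hN, i, hi, hiN, a, ha, hax⟩ := (rte_memC hn).1 h
  obtain ⟨h1, h2⟩ := rte_tower T (B := B) hb (hA N ha).1 (u := m) (v := i * n)
    (by
      intro j hj hjm
      rcases hjm.lt_or_eq with h' | rfl
      · exact hm j hj h'
      · exact hd)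
    (fun j hj hji => (hA N ha).2.2 j hj (by omega)) hax.symm
  subst h2
  exact ⟨N, hN, i, hi, hiN, ha, h1⟩

theorem rte_step (hn : 1 ≤ n) (hA : ∀ N, A N ⊆ retLevel T B N) (hS : ∀ N ∈ S, 2 * n ≤ N)
    {a : X} {N j : ℕ}
    (ha : a ∈ A N) (hN : N ∈ S) (hj : 1 ≤ j) (hjN : j < N)
    (h : (⇑T)^[j] a ∈ B ∪ rteC T S n A) : n ∣ j ∧ j + n ≤ N := by
  have hh := hA N ha
  rcases h with h | h
  · exact absurd h (hh.2.2 j hj hjN)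
  · obtain ⟨N', hN', i, hi, hiN, ha', rfl⟩ := rte_key hn hA hh.1
      (fun j' h1 h2 => hh.2.2 j' h1 (by omega)) h
    have := hS N hN
    have := hS N' hN'
    have : N = N' := rte_unique (by omega) (by omega) hh (hA N' ha')
    subst this
    exact ⟨⟨i, by ring⟩, hiN⟩

theorem rte_F1 (hn : 1 ≤ n) (hA : ∀ N, A N ⊆ retLevel T B N) {x : X} {k : ℕ}
    (hx : x ∈ retLevel T B k) (hxA : ∀ N ∈ S, x ∉ A N) : x ∈ retLevel T (B ∪ rteC T S n A) k := by
  refine ⟨Or.inl hx.1, Or.inl hx.2.1, fun m hm hmk h => ?_⟩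
  rcases h with h | h
  · exact hx.2.2 m hm hmk h
  · obtain ⟨N, hN, i, hi, hiN, ha', rfl⟩ := rte_key hn hA hx.1
      (fun j' h1 h2 => hx.2.2 j' h1 (by omega)) h
    exact hxA N hN ha'

theorem rte_base (hn : 1 ≤ n) (hA : ∀ N, A N ⊆ retLevel T B N) {a : X} {N i : ℕ}
    (ha : a ∈ A N) (hN : N ∈ S) (hi : i * n + n ≤ N) :
    (⇑T)^[i * n] a ∈ B ∪ rteC T S n A := by
  rcases Nat.eq_zero_or_pos i with rfl | h
  · left; simpa using (hA N ha).1
  · right; exact (rte_memC hn).2 ⟨N, hN, i, h, hi, a, ha, rfl⟩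

theorem rte_F2 (hn : 1 ≤ n) (hA : ∀ N, A N ⊆ retLevel T B N) (hS : ∀ N ∈ S, 2 * n ≤ N)
    {a : X} {N i : ℕ} (ha : a ∈ A N) (hN : N ∈ S) (hi : i * n + 2 * n ≤ N) :
    (⇑T)^[i * n] a ∈ retLevel T (B ∪ rteC T S n A) n := by
  refine ⟨rte_base hn hA ha hN (by omega), ?_, fun m hm hmn h => ?_⟩
  · rw [← Function.iterate_add_apply, show n + i * n = (i + 1) * n by ring]
    exact rte_base hn hA ha hN (by linarith)
  · rw [← Function.iterate_add_apply] at h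
    have := (rte_step hn hA hS ha hN (by omega) (by omega) h).1
    rw [Nat.dvd_add_left ⟨i, by ring⟩] at this
    have := Nat.le_of_dvd (by omega) this
    omega

theorem rte_F3 (hn : 1 ≤ n) (hA : ∀ N, A N ⊆ retLevel T B N) (hS : ∀ N ∈ S, 2 * n ≤ N)
    {a : X} {N i k : ℕ} (ha : a ∈ A N) (hN : N ∈ S) (hi : i * n + k = N) (hk : n ≤ k)
    (hk2 : k < 2 * n) :
    (⇑T)^[i * n] a ∈ retLevel T (B ∪ rteC T S n A) k := by
  refine ⟨rte_base hn hA ha hN (by omega), ?_, fun m hm hmn h => ?_⟩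
  · rw [← Function.iterate_add_apply, show k + i * n = N by omega]
    exact Or.inl (hA N ha).2.1
  · rw [← Function.iterate_add_apply] at h
    obtain ⟨h1, h2⟩ := rte_step hn hA hS ha hN (by omega) (by omega) h
    rw [Nat.dvd_add_left ⟨i, by ring⟩] at h1
    have := Nat.le_of_dvd (by omega) h1
    omega

theorem rte_conv (hn : 1 ≤ n) (hA : ∀ N, A N ⊆ retLevel T B N) (hS : ∀ N ∈ S, 2 * n ≤ N)
    {x : X} {k : ℕ} (hk : 1 ≤ k) (hx : x ∈ retLevel T (B ∪ rteC T S n A) k) :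
    x ∈ retLevel T B k ∨ (k = n ∧ x ∈ rteD T S n A) ∨
      (n < k ∧ k < 2 * n ∧ ∃ N ∈ S, x ∈ (⇑T)^[N - k] '' (A N)) := by
  have hcol : ∀ N ∈ S, ∀ i, i * n + n ≤ N → ∀ a ∈ A N, (⇑T)^[i * n] a = x →
      (k = n ∧ x ∈ rteD T S n A) ∨
      (n < k ∧ k < 2 * n ∧ ∃ N ∈ S, x ∈ (⇑T)^[N - k] '' (A N)) := by
    intro N hN i hi a ha hax
    rcases Nat.lt_or_ge N (i * n + 2 * n) with h | h
    · have h3 := rte_F3 (k := N - i * n) (i := i) hn hA hS ha hN (by omega) (by omega) (by omega)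
      rw [hax] at h3
      have hkk := rte_unique hk (by omega) hx h3
      rcases Nat.lt_or_ge n k with h' | h'
      · right
        refine ⟨h', by omega, N, hN, a, ha, ?_⟩
        rw [← hax]; congr 1; congr 1; omega
      · left
        exact ⟨by omega, (rte_memD hn).2 ⟨N, hN, i, Or.inr (by omega), a, ha, hax⟩⟩
    · have h3 := rte_F2 hn hA hS ha hN h
      rw [hax] at h3
      exact Or.inl ⟨rte_unique hk hn hx h3, (rte_memD hn).2 ⟨N, hN, i, Or.inl h, a, ha, hax⟩⟩
  have hxA : ∀ N ∈ S, x ∈ A N → (k = n ∧ x ∈ rteD T S n A) ∨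
      (n < k ∧ k < 2 * n ∧ ∃ N ∈ S, x ∈ (⇑T)^[N - k] '' (A N)) := by
    intro N hN hxN
    exact hcol N hN 0 (by have := hS N hN; omega) x hxN (by simp)
  rcases hx.1 with hb | hc
  · rcases hx.2.1 with h | h
    · exact Or.inl ⟨hb, h, fun m h1 h2 h3 => hx.2.2 m h1 h2 (Or.inl h3)⟩
    · obtain ⟨N, hN, i, hi, hiN, ha', _⟩ := rte_key hn hA hb
        (fun j' h1 h2 h3 => hx.2.2 j' h1 h2 (Or.inl h3)) h
      exact Or.inr (hxA N hN ha')
  · obtain ⟨N, hN, i, hi, hiN, a, ha, hax⟩ := (rte_memC hn).1 hc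
    exact Or.inr (hcol N hN i hiN a ha hax)

theorem rte_low (hn : 1 ≤ n) (hA : ∀ N, A N ⊆ retLevel T B N) (hS : ∀ N ∈ S, 2 * n ≤ N)
    {k : ℕ} (hk : 1 ≤ k) (hkn : k < n) :
    retLevel T (B ∪ rteC T S n A) k = retLevel T B k := by
  ext x
  constructor
  · intro hx
    rcases rte_conv hn hA hS hk hx with h | h | h
    · exact h
    · omega
    · omega
  · intro hx
    refine rte_F1 hn hA hx fun N hN h => ?_
    have := hS N hN
    have := rte_unique hk (by omega) hx (hA N h)
    omega

theorem rte_eqn (hn : 1 ≤ n) (hA : ∀ N, A N ⊆ retLevel T B N) (hS : ∀ N ∈ S, 2 * n ≤ N) :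
    retLevel T (B ∪ rteC T S n A) n = retLevel T B n ∪ rteD T S n A := by
  ext x
  constructor
  · intro hx
    rcases rte_conv hn hA hS hn hx with h | h | h
    · exact Or.inl h
    · exact Or.inr h.2
    · omega
  · rintro (hx | hx)
    · refine rte_F1 hn hA hx fun N hN h => ?_
      have := hS N hN
      have := rte_unique hn (by omega) hx (hA N h)
      omega
    · obtain ⟨N, hN, i, hi, a, ha, rfl⟩ := (rte_memD hn).1 hx
      rcases hi with hi | hi
      · exact rte_F2 hn hA hS ha hN hi
      · exact rte_F3 hn hA hS ha hN hi le_rfl (by omega)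

theorem rte_disjD (hn : 1 ≤ n) (hA : ∀ N, A N ⊆ retLevel T B N) (hS : ∀ N ∈ S, 2 * n ≤ N) :
    Disjoint (retLevel T B n) (rteD T S n A) := by
  rw [Set.disjoint_left]
  intro x hx hxD
  obtain ⟨N, hN, i, hi, a, ha, rfl⟩ := (rte_memD hn).1 hxD
  have h2 := hS N hN
  rcases Nat.eq_zero_or_pos i with rfl | h
  · rw [Nat.zero_mul] at hx
    have := rte_unique hn (by omega) hx (hA N ha)
    omega
  · exact (hA N ha).2.2 (i * n) (by nlinarith) (by omega) hx.1

theorem rte_measD [StandardBorelSpace X] {lam : Measure X} (hT : MeasurePreserving (⇑T) lam lam)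
    (hn : 1 ≤ n) (hA : ∀ N, A N ⊆ retLevel T B N) (hS : ∀ N ∈ S, 2 * n ≤ N)
    (hAm : ∀ N, MeasurableSet (A N)) :
    MeasurableSet (rteD T S n A) ∧ lam (rteD T S n A) = ∑ N ∈ S, (rteg n N : ℝ≥0∞) * lam (A N) := by
  constructor
  · exact Finset.measurableSet_biUnion _ fun p _ => (rte_image hT _ (hAm _)).1
  · unfold rteD
    rw [measure_biUnion_finset]
    · rw [Finset.sum_sigma]
      refine Finset.sum_congr rfl fun N _ => ?_
      simp only [(rte_image hT _ (hAm N)).2]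
      simp
    · rintro ⟨N, i⟩ hp ⟨N', i'⟩ hp' hne
      simp only [Finset.coe_sigma, Set.mem_sigma_iff, Finset.mem_coe, Finset.mem_range,
        rteg_iff hn] at hp hp'
      simp only [Function.onFun]
      rw [Set.disjoint_left]
      rintro x ⟨a, ha, hax⟩ ⟨b, hb, hbx⟩
      simp only at ha hb hax hbx
      have h1 := hA _ ha
      have h2 := hA _ hb
      obtain ⟨e1, e2⟩ := rte_tower T (B := B) h1.1 h2.1 (u := i * n) (v := i' * n)
        (fun j hj hji => h1.2.2 j hj (by omega))
        (fun j hj hji => h2.2.2 j hj (by omega)) (hax.trans hbx.symm)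
      subst e2
      have := hS _ hp.1
      have := hS _ hp'.1
      have e3 : N = N' := rte_unique (by omega) (by omega) h1 h2
      have e4 : i = i' := Nat.eq_of_mul_eq_mul_right hn e1
      subst e3 e4
      exact hne rfl
    · exact fun p _ => (rte_image hT _ (hAm _)).1

theorem rte_high [StandardBorelSpace X] {lam : Measure X} (hT : MeasurePreserving (⇑T) lam lam)
    (hn : 1 ≤ n) (hA : ∀ N, A N ⊆ retLevel T B N) (hS : ∀ N ∈ S, 2 * n ≤ N)
    (hAm : ∀ N, MeasurableSet (A N)) {k : ℕ} (hk : n < k) :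
    lam (retLevel T (B ∪ rteC T S n A) k) ≤
      lam (retLevel T B k) + (if k < 2 * n then ∑ N ∈ S, lam (A N) else 0) := by
  split_ifs with h
  · calc _ ≤ lam (retLevel T B k ∪ ⋃ N ∈ S, (⇑T)^[N - k] '' (A N)) := by
          apply measure_mono
          intro x hx
          rcases rte_conv hn hA hS (by omega) hx with h | h | h
          · exact Or.inl h
          · omega
          · obtain ⟨_, _, N, hN, hx⟩ := h
            right
            simp only [mem_iUnion]
            exact ⟨N, hN, hx⟩
      _ ≤ lam (retLevel T B k) + ∑ N ∈ S, lam ((⇑T)^[N - k] '' (A N)) :=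
          (measure_union_le _ _).trans (add_le_add le_rfl (measure_biUnion_finset_le _ _))
      _ = _ := by simp only [(rte_image hT _ (hAm _)).2]
  · rw [add_zero]
    apply measure_mono
    intro x hx
    rcases rte_conv hn hA hS (by omega) hx with h | h | h
    · exact h
    · omega
    · omega

/-- Kac-type estimate. -/
theorem rte_kac [StandardBorelSpace X] {lam : Measure X} (hT : MeasurePreserving (⇑T) lam lam)
    (hcons : Conserv lam T) (hB : MeasurableSet B)
    (hBorb : ∀ᵐ x ∂lam, ∃ n : ℤ, ⇑(T.toEquiv ^ n) x ∈ B) :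
    lam univ ≤ ∑' N : ℕ, (N : ℝ≥0∞) * lam (retLevel T B N) := by
  have hmT : ∀ m, Measurable ((⇑T)^[m]) := fun m => T.measurable.iterate m
  have hsymm : MeasurePreserving (⇑T.symm) lam lam := hT.symm T
  have hmS : ∀ m, Measurable ((⇑T.symm)^[m]) := fun m => T.symm.measurable.iterate m
  have hTS : ∀ m x, (⇑T)^[m] ((⇑T.symm)^[m] x) = x := fun m =>
    (Function.LeftInverse.iterate T.apply_symm_apply m)
  have hST : ∀ m x, (⇑T.symm)^[m] ((⇑T)^[m] x) = x := fun m =>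
    (Function.LeftInverse.iterate T.symm_apply_apply m)
  -- future and past returns
  have hW : ∀ᵐ x ∂lam, x ∈ B → ∃ m, 1 ≤ m ∧ (⇑T)^[m] x ∈ B := by
    rcases eq_or_ne (lam B) 0 with h | h
    · filter_upwards [measure_eq_zero_iff_ae_notMem.1 h] with x hx hx'
      exact absurd hx' hx
    · exact hcons B hB (pos_iff_ne_zero.2 h)
  have hW' : ∀ᵐ x ∂lam, x ∈ B → ∃ m, 1 ≤ m ∧ (⇑T.symm)^[m] x ∈ B := by
    set W : Set X := B ∩ ⋂ m : ℕ, ⋂ _ : 1 ≤ m, ((⇑T.symm)^[m] ⁻¹' B)ᶜ with hWdef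
    have hWm : MeasurableSet W := hB.inter (MeasurableSet.iInter fun m =>
      MeasurableSet.iInter fun _ => (hmS m hB).compl)
    have hmemW : ∀ x, x ∈ W ↔ x ∈ B ∧ ∀ m, 1 ≤ m → (⇑T.symm)^[m] x ∉ B := by
      intro x; simp [hWdef]
    have h0 : lam W = 0 := by
      by_contra h
      have hc := hcons W hWm (pos_iff_ne_zero.2 h)
      apply h
      rw [measure_eq_zero_iff_ae_notMem]
      filter_upwards [hc] with x hx hxW
      obtain ⟨m, hm, hmW⟩ := hx hxW
      refine ((hmemW _).1 hmW).2 m hm ?_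
      rw [hST]; exact ((hmemW _).1 hxW).1
    filter_upwards [measure_eq_zero_iff_ae_notMem.1 h0] with x hx hxB
    by_contra hcon
    push Not at hcon
    exact hx ((hmemW x).2 ⟨hxB, hcon⟩)
  have hWall : ∀ᵐ x ∂lam, ∀ j, (⇑T.symm)^[j] x ∈ B → ∃ m, 1 ≤ m ∧ (⇑T)^[m] ((⇑T.symm)^[j] x) ∈ B :=
    ae_all_iff.2 fun j => (hsymm.iterate j).quasiMeasurePreserving.ae hW
  have hWall' : ∀ᵐ x ∂lam, ∀ j, (⇑T)^[j] x ∈ B → ∃ m, 1 ≤ m ∧ (⇑T.symm)^[m] ((⇑T)^[j] x) ∈ B :=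
    ae_all_iff.2 fun j => (hT.iterate j).quasiMeasurePreserving.ae hW'
  have hcover : ∀ᵐ x ∂lam, x ∈ ⋃ N : ℕ, ⋃ m ∈ Finset.range N, (⇑T)^[m] '' (retLevel T B N) := by
    classical
    filter_upwards [hWall, hWall', hBorb] with x h1 h2 h3
    have hpast : ∃ m, (⇑T.symm)^[m] x ∈ B := by
      obtain ⟨z, hz⟩ := h3
      rcases Int.eq_nat_or_neg z with ⟨j, rfl | rfl⟩
      · have hz : (⇑T)^[j] x ∈ B := by
          rw [zpow_natCast] at hz
          have : ⇑(T.toEquiv ^ j) = (⇑T)^[j] := Equiv.Perm.iterate_eq_pow T.toEquiv j |>.symm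
          rwa [this] at hz
        have hex : ∃ j, (⇑T)^[j] x ∈ B := ⟨j, hz⟩
        obtain ⟨m, hm, hmB⟩ := h2 _ (Nat.find_spec hex)
        set q := Nat.find hex with hq
        rcases Nat.lt_or_ge m q with hlt | hge
        · exfalso
          obtain ⟨w, hw⟩ := Nat.exists_eq_add_of_lt hlt
          rw [show q = m + (w + 1) by omega, Function.iterate_add_apply, hST] at hmB
          exact Nat.find_min hex (m := w + 1) (by omega) hmB
        · obtain ⟨w, rfl⟩ := Nat.exists_eq_add_of_le hge
          rw [add_comm, Function.iterate_add_apply, hST] at hmB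
          exact ⟨w, hmB⟩
      · refine ⟨j, ?_⟩
        rw [zpow_neg, zpow_natCast] at hz
        have e : (T.toEquiv ^ j)⁻¹ x = (⇑T.symm)^[j] x := by
          rw [Equiv.Perm.inv_eq_iff_eq]
          have : ⇑(T.toEquiv ^ j) = (⇑T)^[j] := Equiv.Perm.iterate_eq_pow T.toEquiv j |>.symm
          rw [this, hTS]
        rwa [e] at hz
    have hmin := fun {m} => Nat.find_min hpast (m := m)
    have hspec := Nat.find_spec hpast
    set m := Nat.find hpast with hm
    have hfut : ∃ p, 1 ≤ p ∧ (⇑T)^[p] ((⇑T.symm)^[m] x) ∈ B := h1 m hspec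
    have hpmin := fun {p} => Nat.find_min hfut (m := p)
    have hpspec := Nat.find_spec hfut
    set p := Nat.find hfut with hp
    simp only [mem_iUnion, Finset.mem_range]
    refine ⟨p, m, ?_, (⇑T.symm)^[m] x, ⟨hspec, hpspec.2, fun j hj hjp hjB => hpmin hjp ⟨hj, hjB⟩⟩,
      hTS m x⟩
    by_contra hcon
    push Not at hcon
    obtain ⟨w, hw⟩ := Nat.exists_eq_add_of_le hcon
    have hB' := hpspec.2
    rw [hw, Function.iterate_add_apply, hTS] at hB'
    exact hmin (m := w) (by omega) hB'
  calc lam univ = lam (⋃ N : ℕ, ⋃ m ∈ Finset.range N, (⇑T)^[m] '' (retLevel T B N)) := by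
        refine measure_congr ?_
        filter_upwards [hcover] with x hx
        exact propext ⟨fun _ => hx, fun _ => trivial⟩
    _ ≤ ∑' N : ℕ, lam (⋃ m ∈ Finset.range N, (⇑T)^[m] '' (retLevel T B N)) := measure_iUnion_le _
    _ ≤ ∑' N : ℕ, (N : ℝ≥0∞) * lam (retLevel T B N) := by
        refine ENNReal.tsum_le_tsum fun N => (measure_biUnion_finset_le _ _).trans ?_
        simp only [(rte_image hT _ (rte_meas hB N)).2]
        simp

theorem rte_sum_le {lam : Measure X} (hB : MeasurableSet B) :
    ∑' N : ℕ, lam (retLevel T B (N + 1)) ≤ lam B := by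
  rw [← measure_iUnion]
  · exact measure_mono (iUnion_subset fun N x hx => hx.1)
  · intro p q hpq
    simp only [Function.onFun]
    rw [Set.disjoint_left]
    intro x h1 h2
    have := rte_unique (by omega) (by omega) h1 h2
    omega
  · exact fun N => rte_meas hB _

theorem rteg_bound {N : ℕ} (hn : 1 ≤ n) (hN : 2 * n ≤ N) : N ≤ 4 * n * rteg n N := by
  have h1 : N / n - 1 ≤ rteg n N := by
    unfold rteg
    split_ifs
    · exact Nat.sub_le _ _
    · exact le_rfl
  have h2 : 2 ≤ N / n := (Nat.le_div_iff_mul_le hn).2 hN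
  have h3 : N < n * (N / n + 1) := Nat.lt_mul_div_succ N hn
  have h4 : N / n + 1 ≤ 4 * rteg n N := by omega
  nlinarith

end

theorem return_time_expansion_at_level_n
    [MeasurableSpace X] [StandardBorelSpace X]
    (lam : Measure X) [SigmaFinite lam] [NullSingletonClass lam] (hX : lam univ = ∞)
    (T : X ≃ᵐ X) (hT : MeasurePreserving (⇑T) lam lam)
    (hcons : Conserv lam T) (hap : Aperiodic lam T)
    (B : Set X) (hB : MeasurableSet B) (hBfin : lam B < ∞)
    (hBorb : ∀ᵐ x ∂lam, ∃ n : ℤ, ⇑(T.toEquiv ^ n) x ∈ B)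
    (n : ℕ) (hn : 1 ≤ n) (l : ℕ → ℝ)
    (hl : ∀ k, n ≤ k → lam (retLevel T B k) < ENNReal.ofReal (l k)) :
    ∃ C : Set X, MeasurableSet C ∧ Disjoint B C ∧
      (∀ k, 1 ≤ k → k < n →
        lam ((retLevel T (B ∪ C) k \ retLevel T B k) ∪
          (retLevel T B k \ retLevel T (B ∪ C) k)) = 0) ∧
      lam (retLevel T (B ∪ C) n) = ENNReal.ofReal (l n) ∧
      ∀ k, n < k → lam (retLevel T (B ∪ C) k) < ENNReal.ofReal (l k) := by
  have hfin : ∀ N, lam (retLevel T B N) ≠ ∞ := fun N =>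
    ((measure_mono (fun x hx => hx.1)).trans_lt hBfin).ne
  have hkac := rte_kac hT hcons hB hBorb
  rw [hX, top_le_iff] at hkac
  have hsum : ∑' N : ℕ, lam (retLevel T B (N + 1)) ≠ ∞ := ((rte_sum_le hB).trans_lt hBfin).ne
  -- choose M
  have htail := ENNReal.tendsto_sum_nat_add _ hsum
  have hev : ∀ᶠ M in Filter.atTop, ∀ k ∈ Finset.Ioo n (2 * n),
      lam (retLevel T B k) + ∑' j, lam (retLevel T B (j + M + 1)) < ENNReal.ofReal (l k) := by
    rw [Filter.eventually_all_finset]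
    intro k hk
    rw [Finset.mem_Ioo] at hk
    have := (tendsto_const_nhds (x := lam (retLevel T B k))).add htail
    rw [add_zero] at this
    exact this.eventually (gt_mem_nhds (hl k hk.1.le))
  obtain ⟨M, hM, hM2⟩ := (hev.and (Filter.eventually_ge_atTop (2 * n))).exists
  -- the tail of the weighted sum diverges
  have hdiv : ∑' j : ℕ, (rteg n (j + (M + 1)) : ℝ≥0∞) * lam (retLevel T B (j + (M + 1))) = ∞ := by
    by_contra hne
    have hle : ∑' j : ℕ, ((j + (M + 1) : ℕ) : ℝ≥0∞) * lam (retLevel T B (j + (M + 1))) ≤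
        (4 * n : ℕ) * ∑' j : ℕ, (rteg n (j + (M + 1)) : ℝ≥0∞) * lam (retLevel T B (j + (M + 1))) := by
      rw [← ENNReal.tsum_mul_left]
      refine ENNReal.tsum_le_tsum fun j => ?_
      rw [← mul_assoc]
      gcongr
      exact_mod_cast rteg_bound (N := j + (M + 1)) hn (by omega)
    have h1 := ENNReal.summable.sum_add_tsum_nat_add' (k := M + 1)
      (f := fun N : ℕ => (N : ℝ≥0∞) * lam (retLevel T B N))
    rw [hkac] at h1
    have h2 : ∑ i ∈ Finset.range (M + 1), (i : ℝ≥0∞) * lam (retLevel T B i) ≠ ∞ := by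
      rw [ENNReal.sum_ne_top]
      exact fun i _ => ENNReal.mul_ne_top (by simp) (hfin i)
    have h3 := (hle.trans_lt (ENNReal.mul_lt_top (ENNReal.natCast_lt_top _)
      (lt_top_iff_ne_top.2 hne))).ne
    exact (ENNReal.add_ne_top.2 ⟨h2, h3⟩) h1
  set e : ℝ≥0∞ := ENNReal.ofReal (l n) - lam (retLevel T B n) with he
  have hetop : e < ∞ := (tsub_le_self).trans_lt ENNReal.ofReal_lt_top
  have hK := ENNReal.tendsto_nat_tsum
    (fun j : ℕ => (rteg n (j + (M + 1)) : ℝ≥0∞) * lam (retLevel T B (j + (M + 1))))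
  rw [hdiv] at hK
  obtain ⟨K, hK⟩ := (hK.eventually (lt_mem_nhds hetop)).exists
  set S : Finset ℕ := (Finset.range K).map (addRightEmbedding (M + 1)) with hSdef
  have hSsum : ∀ f : ℕ → ℝ≥0∞, ∑ N ∈ S, f N = ∑ j ∈ Finset.range K, f (j + (M + 1)) := by
    intro f; simp [hSdef]
  have hS : ∀ N ∈ S, 2 * n ≤ N := by
    intro N hN
    simp only [hSdef, Finset.mem_map, addRightEmbedding_apply] at hN
    obtain ⟨j, _, rfl⟩ := hN
    omega
  set ν : Measure X := ∑ N ∈ S, (rteg n N : ℝ≥0∞) • lam.restrict (retLevel T B N) with hν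
  have hνapp : ∀ s, MeasurableSet s → ν s = ∑ N ∈ S, (rteg n N : ℝ≥0∞) * lam (s ∩ retLevel T B N) := by
    intro s hs
    simp [hν, Measure.finsetSum_apply, Measure.restrict_apply hs]
  have hνfin : IsFiniteMeasure ν := by
    constructor
    rw [hνapp _ MeasurableSet.univ, ENNReal.sum_lt_top]
    intro N _
    rw [univ_inter]
    exact ENNReal.mul_lt_top (ENNReal.natCast_lt_top _) (lt_top_iff_ne_top.2 (hfin N))
  obtain ⟨A0, hA0, hA0e⟩ := rte_exists_measure_eq ν (by
      intro x
      rw [hνapp _ (measurableSet_singleton x)]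
      refine Finset.sum_eq_zero fun N _ => ?_
      rw [measure_mono_null inter_subset_left (measure_singleton x), mul_zero]) e (by
      rw [hνapp _ MeasurableSet.univ, hSsum]
      simpa using hK)
  rw [hνapp _ hA0] at hA0e
  set A : ℕ → Set X := fun N => A0 ∩ retLevel T B N with hAdef
  have hA : ∀ N, A N ⊆ retLevel T B N := fun N => inter_subset_right
  have hAm : ∀ N, MeasurableSet (A N) := fun N => hA0.inter (rte_meas hB N)
  refine ⟨rteC T S n A, ?_, ?_, ?_, ?_, ?_⟩
  · exact Finset.measurableSet_biUnion _ fun N _ => Finset.measurableSet_biUnion _ fun i _ =>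
      (rte_image hT _ (hAm _)).1
  · rw [Set.disjoint_right]
    exact fun x hx => rte_disj hn hA hx
  · intro k hk hkn
    rw [rte_low hn hA hS hk hkn]
    simp
  · obtain ⟨h1, h2⟩ := rte_measD hT hn hA hS hAm
    rw [rte_eqn hn hA hS, measure_union (rte_disjD hn hA hS) h1, h2, hA0e, he]
    exact add_tsub_cancel_of_le (hl n le_rfl).le
  · intro k hk
    refine (rte_high hT hn hA hS hAm hk).trans_lt ?_
    split_ifs with h
    · refine lt_of_le_of_lt ?_ (hM k (Finset.mem_Ioo.2 ⟨hk, h⟩))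
      gcongr
      rw [hSsum]
      refine (Finset.sum_le_sum fun j _ => measure_mono (hA _)).trans ?_
      exact ENNReal.sum_le_tsum (f := fun j => lam (retLevel T B (j + M + 1))) _
    · rw [add_zero]
      exact hl k hk.le
end

section
/- Let (X, λ) be a standard Borel space with an atomless σ-finite measure satisfying λ(X) = ∞, let T ∈ Aut(X, λ) be conservative and aperiodic, and let A ⊆ X be a Borel set with λ(A) < ∞ intersecting the T-orbit of λ-a.e. point of X. Then for every sequence of real numbers (λ_n)_{n ≥ 1} with λ_n > λ(τ_{A,T}⁻¹(n)) for all n ≥ 1, there exists a Borel set B with A ⊆ B such that λ(τ_{B,T}⁻¹(n)) = λ_n for every n ≥ 1. -/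
open MeasureTheory Set
open scoped ENNReal

variable {X : Type*}

lemma ivt_measure [MeasurableSpace X] [StandardBorelSpace X] (ν : Measure X) [IsFiniteMeasure ν]
    [NullSingletonClass ν] (d : ℝ≥0∞) (hd : d < ν univ) : ∃ S, MeasurableSet S ∧ ν S = d := by
  obtain ⟨f, hf⟩ := exists_measurableEmbedding_real X
  let ρ := ν.map f
  have hρs : NullSingletonClass ρ := ⟨fun x => by
    rw [Measure.map_apply hf.measurable (measurableSet_singleton x)]
    exact Set.Subsingleton.measure_zero
      (fun a ha b hb => hf.injective ((show f a = x from ha).trans (show f b = x from hb).symm)) ν⟩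
  have hρf : IsFiniteMeasure ρ := inferInstance
  have hU : ρ univ = ν univ := by
    rw [Measure.map_apply hf.measurable MeasurableSet.univ]; simp
  have hun : (⋃ k : ℕ, Ioc (-(k:ℝ)) k) = univ := by
    apply eq_univ_of_forall
    intro x
    obtain ⟨k, hk⟩ := exists_nat_gt |x|
    exact mem_iUnion.2 ⟨k, by have := abs_lt.1 hk; exact ⟨this.1, this.2.le⟩⟩
  have hmono : Monotone (fun k : ℕ => Ioc (-(k:ℝ)) k) := by
    intro a b hab
    have : (a:ℝ) ≤ b := by exact_mod_cast hab
    exact Ioc_subset_Ioc (by linarith) this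
  have ht := tendsto_measure_iUnion_atTop (μ := ρ) hmono
  rw [hun, hU] at ht
  obtain ⟨k, hk⟩ := (ht.eventually (lt_mem_nhds hd)).exists
  have hc : Continuous (fun b => ∫ x in (-(k:ℝ))..b, (1:ℝ) ∂ρ) :=
    intervalIntegral.continuous_primitive (fun a b => by simp) _
  have hdt : d ≠ ∞ := (hd.trans_le le_top).ne
  have hval : ∀ b, -(k:ℝ) ≤ b → ∫ x in (-(k:ℝ))..b, (1:ℝ) ∂ρ = (ρ (Ioc (-(k:ℝ)) b)).toReal := by
    intro b hb
    rw [intervalIntegral.integral_of_le hb]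
    simp [Measure.real]
  have hkk : -(k:ℝ) ≤ k := by have := Nat.cast_nonneg (α := ℝ) k; linarith
  have hmem : d.toReal ∈ Icc ((fun b => ∫ x in (-(k:ℝ))..b, (1:ℝ) ∂ρ) (-(k:ℝ)))
      ((fun b => ∫ x in (-(k:ℝ))..b, (1:ℝ) ∂ρ) k) := by
    constructor
    · simp
    · simp only [hval _ hkk]
      exact ENNReal.toReal_mono (measure_ne_top _ _) hk.le
  obtain ⟨b, hb, hbe⟩ := intermediate_value_Icc hkk hc.continuousOn hmem
  refine ⟨f ⁻¹' (Ioc (-(k:ℝ)) b), hf.measurable measurableSet_Ioc, ?_⟩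
  rw [← Measure.map_apply hf.measurable measurableSet_Ioc]
  simp only [hval _ hb.1] at hbe
  exact (ENNReal.toReal_eq_toReal_iff' (measure_ne_top _ _) hdt).1 hbe

lemma measurableSet_retLevel [MeasurableSpace X] (T : X ≃ᵐ X) {B : Set X} (hB : MeasurableSet B)
    (k : ℕ) : MeasurableSet (retLevel T B k) := by
  have h : ∀ m, MeasurableSet {x | (⇑T)^[m] x ∈ B} := fun m => (T.measurable.iterate m) hB
  have : retLevel T B k = B ∩ ({x | (⇑T)^[k] x ∈ B} ∩
      ⋂ m : ℕ, ⋂ (_ : 1 ≤ m), ⋂ (_ : m < k), {x | (⇑T)^[m] x ∈ B}ᶜ) := by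
    ext x; simp only [retLevel, mem_inter_iff, mem_iInter, mem_compl_iff, mem_ofPred_eq]
  rw [this]
  exact hB.inter ((h k).inter (MeasurableSet.iInter fun m => MeasurableSet.iInter fun _ =>
    MeasurableSet.iInter fun _ => (h m).compl))

lemma iter_image_eq [MeasurableSpace X] (T : X ≃ᵐ X) (j : ℕ) (D : Set X) :
    (⇑T)^[j] '' D = (⇑T.symm)^[j] ⁻¹' D := by
  apply congrFun
  apply image_eq_preimage_of_inverse
  · exact Function.LeftInverse.iterate T.symm_apply_apply j
  · exact Function.RightInverse.iterate T.apply_symm_apply j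

lemma measurableSet_iter_image [MeasurableSpace X] (T : X ≃ᵐ X) (j : ℕ) {D : Set X}
    (hD : MeasurableSet D) : MeasurableSet ((⇑T)^[j] '' D) := by
  rw [iter_image_eq]; exact (T.symm.measurable.iterate j) hD

lemma measure_iter_image [MeasurableSpace X] {lam : Measure X} (T : X ≃ᵐ X)
    (hT : MeasurePreserving (⇑T) lam lam) (j : ℕ) {D : Set X}
    (hD : MeasurableSet D) : lam ((⇑T)^[j] '' D) = lam D := by
  rw [iter_image_eq]
  exact ((hT.symm T).iterate j).measure_preimage hD.nullMeasurableSet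

lemma cover [MeasurableSpace X] (lam : Measure X)
    (T : X ≃ᵐ X) (hT : MeasurePreserving (⇑T) lam lam) (hcons : Conserv lam T)
    (A : Set X) (hA : MeasurableSet A)
    (hAorb : ∀ᵐ x ∂lam, ∃ n : ℤ, ⇑(T.toEquiv ^ n) x ∈ A)
    (B : Set X) (hAB : A ⊆ B) :
    ∀ᵐ x ∂lam, ∃ N, ∃ j < N, x ∈ (⇑T)^[j] '' retLevel T B N := by
  have c1 : Conservative (⇑T) lam := by
    refine ⟨hT.quasiMeasurePreserving, fun s hs h0 => ?_⟩
    have h1 := hcons s hs (pos_iff_ne_zero.2 h0)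
    have h2 : ∃ᵐ x ∂lam, x ∈ s := frequently_ae_mem_iff.2 h0
    obtain ⟨x, hx, h⟩ := (h2.and_eventually h1).exists
    obtain ⟨n, hn, hh⟩ := h hx
    exact ⟨x, hx, n, by omega, hh⟩
  have c2 : Conservative (⇑T.symm) lam := by
    refine ⟨(hT.symm T).quasiMeasurePreserving, fun s hs h0 => ?_⟩
    obtain ⟨x, hx, m, hm, hxm⟩ := c1.exists_mem_iterate_mem' hs h0
    refine ⟨_, hxm, m, hm, ?_⟩
    rwa [Function.LeftInverse.iterate T.symm_apply_apply m x]
  have r1 := c1.ae_mem_imp_frequently_image_mem hA.nullMeasurableSet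
  have r2 := c2.ae_mem_imp_frequently_image_mem hA.nullMeasurableSet
  have r3 := r1.and r2
  have f1 : ∀ᵐ x ∂lam, ∀ n : ℕ, _ := ae_all_iff.2 fun n =>
    (c1.toQuasiMeasurePreserving.iterate n).ae r3
  have f2 : ∀ᵐ x ∂lam, ∀ n : ℕ, _ := ae_all_iff.2 fun n =>
    (c2.toQuasiMeasurePreserving.iterate n).ae r3
  filter_upwards [f1, f2, hAorb] with x h1 h2 h3
  have hTS : ∀ (p q : ℕ) y, (⇑T)^[p+q] ((⇑T.symm)^[q] y) = (⇑T)^[p] y := by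
    intro p q y
    rw [Function.iterate_add_apply, Function.RightInverse.iterate T.apply_symm_apply q y]
  have hST : ∀ (p q : ℕ) y, (⇑T.symm)^[p+q] ((⇑T)^[q] y) = (⇑T.symm)^[p] y := by
    intro p q y
    rw [Function.iterate_add_apply, Function.LeftInverse.iterate T.symm_apply_apply q y]
  have key : (∃ p, (⇑T)^[p+1] x ∈ B) ∧ (∃ q, (⇑T.symm)^[q] x ∈ B) := by
    obtain ⟨n, hn⟩ := h3
    have hcase : (∃ n : ℕ, (⇑T)^[n] x ∈ A) ∨ (∃ n : ℕ, (⇑T.symm)^[n] x ∈ A) := by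
      rcases n with n | n
      · left; refine ⟨n, ?_⟩
        rw [Int.ofNat_eq_natCast, zpow_natCast, ← Equiv.Perm.iterate_eq_pow] at hn
        exact hn
      · right; refine ⟨n+1, ?_⟩
        rw [zpow_negSucc, ← inv_pow, ← Equiv.Perm.iterate_eq_pow] at hn
        exact hn
    rcases hcase with ⟨n, hn⟩ | ⟨n, hn⟩
    · obtain ⟨g1, g2⟩ := h1 n
      obtain ⟨a, ha, ha'⟩ := Filter.frequently_atTop.1 (g1 hn) 1
      obtain ⟨b, hb, hb'⟩ := Filter.frequently_atTop.1 (g2 hn) n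
      refine ⟨⟨a - 1 + n, hAB ?_⟩, b - n, hAB ?_⟩
      · rw [← Function.iterate_add_apply] at ha'
        rwa [show a - 1 + n + 1 = a + n by omega]
      · rw [← hST _ n, Nat.sub_add_cancel hb]; exact hb'
    · obtain ⟨g1, g2⟩ := h2 n
      obtain ⟨a, ha, ha'⟩ := Filter.frequently_atTop.1 (g1 hn) (n+1)
      refine ⟨⟨a - 1 - n, hAB ?_⟩, n, hAB hn⟩
      rw [← hTS _ n, show a - 1 - n + 1 + n = a by omega]; exact ha'
  obtain ⟨e1, e2⟩ := key
  classical
  set p := Nat.find e1 with hp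
  set q := Nat.find e2 with hq
  have hp1 := Nat.find_spec e1
  have hq1 := Nat.find_spec e2
  refine ⟨p + 1 + q, q, by omega, (⇑T.symm)^[q] x, ⟨hq1, ?_, ?_⟩, ?_⟩
  · rw [hTS]; exact hp1
  · intro m hm hmk
    rcases le_or_gt m q with h | h
    · have : (⇑T)^[m] ((⇑T.symm)^[q] x) = (⇑T.symm)^[q-m] x := by
        conv_lhs => rw [show q = m + (q - m) by omega, Function.iterate_add_apply]
        exact Function.RightInverse.iterate T.apply_symm_apply m _
      rw [this]; exact Nat.find_min e2 (by omega)
    · have : (⇑T)^[m] ((⇑T.symm)^[q] x) = (⇑T)^[m-q-1+1] x := by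
        rw [← hTS (m - q - 1 + 1) q, show m - q - 1 + 1 + q = m by omega]
      rw [this]; exact Nat.find_min e1 (by omega)
  · have := hTS 0 q x
    simpa using this

lemma sum_infty [MeasurableSpace X] (lam : Measure X) (hX : lam univ = ∞)
    (T : X ≃ᵐ X) (hT : MeasurePreserving (⇑T) lam lam) (hcons : Conserv lam T)
    (A : Set X) (hA : MeasurableSet A)
    (hAorb : ∀ᵐ x ∂lam, ∃ n : ℤ, ⇑(T.toEquiv ^ n) x ∈ A)
    (B : Set X) (hB : MeasurableSet B) (hAB : A ⊆ B) :
    ∑' N : ℕ, (N : ℝ≥0∞) * lam (retLevel T B N) = ∞ := by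
  have h := cover lam T hT hcons A hA hAorb B hAB
  have h1 : lam univ ≤ lam (⋃ N, ⋃ j ∈ Finset.range N, (⇑T)^[j] '' retLevel T B N) := by
    apply measure_mono_ae
    filter_upwards [h] with x hx _
    obtain ⟨N, j, hj, hx⟩ := hx
    exact mem_iUnion.2 ⟨N, mem_iUnion₂.2 ⟨j, Finset.mem_range.2 hj, hx⟩⟩
  rw [hX, top_le_iff] at h1
  rw [← top_le_iff, ← h1]
  refine (measure_iUnion_le _).trans (ENNReal.tsum_le_tsum fun N => ?_)
  refine (measure_biUnion_finset_le _ _).trans ?_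
  simp [measure_iter_image T hT _ (measurableSet_retLevel T hB N)]

/-- number of pieces of length `n` cut off an interval of length `N`. -/
def kk (n N : ℕ) : ℕ := (N - n - 1) / n

lemma kk_bounds {n N : ℕ} (hn : 1 ≤ n) (hN : 2 * n < N) :
    1 ≤ kk n N ∧ kk n N * n + n + 1 ≤ N ∧ N ≤ kk n N * n + 2 * n := by
  unfold kk
  have h1 := Nat.div_add_mod (N - n - 1) n
  have h2 := Nat.mod_lt (N - n - 1) hn
  rw [mul_comm] at h1
  refine ⟨(Nat.one_le_div_iff hn).2 (by omega), by omega, by omega⟩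

/-- the refined set -/
def refineSet [MeasurableSpace X] (T : X ≃ᵐ X) (B : Set X) (n : ℕ) (D : ℕ → Set X) : Set X :=
  B ∪ ⋃ N : ℕ, ⋃ j : ℕ, ⋃ (_ : 1 ≤ j ∧ j ≤ kk n N), (⇑T)^[j * n] '' D N

lemma mem_refineSet [MeasurableSpace X] {T : X ≃ᵐ X} {B : Set X} {n : ℕ} {D : ℕ → Set X} {y : X} :
    y ∈ refineSet T B n D ↔ y ∈ B ∨ ∃ N j, (1 ≤ j ∧ j ≤ kk n N) ∧ ∃ x ∈ D N, (⇑T)^[j * n] x = y := by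
  simp only [refineSet, mem_union, mem_iUnion, mem_image, exists_prop]

lemma iter_cancel [MeasurableSpace X] (T : X ≃ᵐ X) {i j : ℕ} (hij : i ≤ j) {x y : X}
    (h : (⇑T)^[i] x = (⇑T)^[j] y) : x = (⇑T)^[j - i] y := by
  rw [show j = i + (j - i) by omega, Function.iterate_add_apply] at h
  exact T.injective.iterate i h

lemma tower_unique [MeasurableSpace X] {T : X ≃ᵐ X} {B : Set X} {N N' i i' : ℕ} {x x' : X}
    (hx : x ∈ retLevel T B N) (hx' : x' ∈ retLevel T B N') (hi : i < N) (hi' : i' < N')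
    (h : (⇑T)^[i] x = (⇑T)^[i'] x') : N = N' ∧ i = i' ∧ x = x' := by
  have aux : i = i' := by
    rcases lt_trichotomy i i' with hlt | heq | hlt
    · have := iter_cancel T hlt.le h
      exact absurd (this ▸ hx.1) (hx'.2.2 _ (by omega) (by omega))
    · exact heq
    · have := iter_cancel T hlt.le h.symm
      exact absurd (this ▸ hx'.1) (hx.2.2 _ (by omega) (by omega))
  subst aux
  have hxx : x = x' := T.injective.iterate i h
  subst hxx
  refine ⟨?_, rfl, rfl⟩
  rcases lt_trichotomy N N' with hlt | heq | hlt
  · exact absurd hx.2.1 (hx'.2.2 _ (by omega) (by omega))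
  · exact heq
  · exact absurd hx'.2.1 (hx.2.2 _ (by omega) (by omega))

section comb
variable [MeasurableSpace X] {T : X ≃ᵐ X} {B : Set X} {n : ℕ} {D : ℕ → Set X}

lemma D_gt (hD0 : ∀ N, N ≤ 2 * n → D N = ∅) {N : ℕ} {x : X} (hx : x ∈ D N) : 2 * n < N := by
  by_contra h
  rw [hD0 N (by omega)] at hx
  exact hx

lemma tower_mem (hn : 1 ≤ n) (hD : ∀ N, D N ⊆ retLevel T B N) (hD0 : ∀ N, N ≤ 2 * n → D N = ∅)
    {N i : ℕ} {x : X} (hx : x ∈ retLevel T B N) (h0 : 1 ≤ i) (hi : i < N)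
    (h : (⇑T)^[i] x ∈ refineSet T B n D) : x ∈ D N ∧ ∃ j, j ≤ kk n N ∧ i = j * n := by
  rcases mem_refineSet.1 h with h | ⟨N', j, ⟨hj, hj'⟩, x', hx', e⟩
  · exact absurd h (hx.2.2 i h0 hi)
  · have hN' := kk_bounds hn (D_gt hD0 hx')
    have := Nat.mul_le_mul_right n hj'
    obtain ⟨rfl, h2, rfl⟩ := tower_unique (hD _ hx') hx (by omega) hi e
    exact ⟨hx', j, hj', h2.symm⟩

lemma new_sub (hn : 1 ≤ n) (hD : ∀ N, D N ⊆ retLevel T B N) (hD0 : ∀ N, N ≤ 2 * n → D N = ∅)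
    {m : ℕ} (hm : 1 ≤ m) {y : X} (hy : y ∈ retLevel T (refineSet T B n D) m) :
    (y ∈ retLevel T B m) ∨ (m = n ∧ ∃ N, ∃ j < kk n N, ∃ x ∈ D N, (⇑T)^[j * n] x = y) ∨
    (n < m ∧ m ≤ 2 * n ∧ ∃ N, ∃ x ∈ D N, (⇑T)^[kk n N * n] x = y) := by
  obtain ⟨hy1, hy2, hy3⟩ := hy
  by_cases hc : ∃ N j, j ≤ kk n N ∧ ∃ x ∈ D N, (⇑T)^[j * n] x = y
  · right
    obtain ⟨N, j, hj, x, hx, rfl⟩ := hc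
    have hN := kk_bounds hn (D_gt hD0 hx)
    have hxr := hD _ hx
    rw [← Function.iterate_add_apply] at hy2
    rcases hj.lt_or_eq with hlt | rfl
    · left
      have hle := Nat.mul_le_mul_right n (show j + 1 ≤ kk n N from hlt)
      rw [add_mul, one_mul] at hle
      have hmn : m ≤ n := by
        by_contra hcon
        refine hy3 n hn (by omega) ?_
        rw [← Function.iterate_add_apply]
        refine mem_refineSet.2 (Or.inr ⟨N, j + 1, ⟨by omega, hlt⟩, x, hx, ?_⟩)
        rw [add_mul, one_mul, add_comm]
      refine ⟨?_, N, j, hlt, x, hx, rfl⟩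
      obtain ⟨-, j', -, hj'⟩ := tower_mem hn hD hD0 hxr (by omega) (by omega) hy2
      have h1 : j < j' := by
        by_contra hcon
        have := Nat.mul_le_mul_right n (show j' ≤ j by omega)
        omega
      have := Nat.mul_le_mul_right n (show j + 1 ≤ j' from h1)
      rw [add_mul, one_mul] at this
      omega
    · right
      have hmN : m ≤ N - kk n N * n := by
        by_contra hcon
        refine hy3 (N - kk n N * n) (by omega) (by omega) ?_
        rw [← Function.iterate_add_apply, Nat.sub_add_cancel (by omega)]
        exact mem_refineSet.2 (Or.inl hxr.2.1)
      have hmN' : m = N - kk n N * n := by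
        by_contra hcon
        obtain ⟨-, j', hj1, hj'⟩ := tower_mem hn hD hD0 hxr (by omega) (by omega) hy2
        have := Nat.mul_le_mul_right n hj1
        omega
      exact ⟨by omega, by omega, N, x, hx, rfl⟩
  · left
    push Not at hc
    have hyB : y ∈ B := by
      rcases mem_refineSet.1 hy1 with h | ⟨N', j, ⟨hj, hj'⟩, x', hx', e⟩
      · exact h
      · exact absurd e (hc N' j hj' x' hx')
    have hsub : ∀ i, 1 ≤ i → i < m → (⇑T)^[i] y ∉ B := fun i h1 h2 h3 =>
      hy3 i h1 h2 (mem_refineSet.2 (Or.inl h3))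
    refine ⟨hyB, ?_, hsub⟩
    rcases mem_refineSet.1 hy2 with h | ⟨N', j, ⟨hj, hj'⟩, x, hx, e⟩
    · exact h
    · exfalso
      have hN := kk_bounds hn (D_gt hD0 hx)
      have hle := Nat.mul_le_mul_right n hj'
      have hle' := Nat.mul_le_mul_right n hj
      have hxr := hD _ hx
      rcases lt_trichotomy (j * n) m with h | h | h
      · have := iter_cancel T h.le e
        exact hsub _ (by omega) (by omega) (this ▸ hxr.1)
      · have := iter_cancel T h.le e
        rw [h, Nat.sub_self] at this
        exact hc N' 0 (Nat.zero_le _) x hx (by simpa using this)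
      · have := iter_cancel T h.le e.symm
        exact hxr.2.2 (j * n - m) (by omega) (by omega) (this ▸ hyB)

lemma old_sub (hn : 1 ≤ n) (hD : ∀ N, D N ⊆ retLevel T B N) (hD0 : ∀ N, N ≤ 2 * n → D N = ∅)
    {m : ℕ} (hm' : m ≤ 2 * n) {y : X} (hy : y ∈ retLevel T B m) :
    y ∈ retLevel T (refineSet T B n D) m := by
  refine ⟨mem_refineSet.2 (Or.inl hy.1), mem_refineSet.2 (Or.inl hy.2.1), fun i h1 h2 h3 => ?_⟩
  have := tower_mem hn hD hD0 hy h1 h2 h3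
  have := D_gt hD0 this.1
  omega

lemma level_lt (hn : 1 ≤ n) (hD : ∀ N, D N ⊆ retLevel T B N) (hD0 : ∀ N, N ≤ 2 * n → D N = ∅)
    {m : ℕ} (hm : 1 ≤ m) (hmn : m < n) :
    retLevel T (refineSet T B n D) m = retLevel T B m := by
  apply Subset.antisymm
  · intro y hy
    rcases new_sub hn hD hD0 hm hy with h | h | h
    · exact h
    · omega
    · omega
  · intro y hy
    exact old_sub hn hD hD0 (by omega) hy

lemma level_eq (hn : 1 ≤ n) (hD : ∀ N, D N ⊆ retLevel T B N) (hD0 : ∀ N, N ≤ 2 * n → D N = ∅) :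
    retLevel T (refineSet T B n D) n =
      retLevel T B n ∪ ⋃ p : (Σ N : ℕ, Fin (kk n N)), (⇑T)^[p.2 * n] '' D p.1 := by
  apply Subset.antisymm
  · intro y hy
    rcases new_sub hn hD hD0 hn hy with h | ⟨-, N, j, hj, h⟩ | h
    · exact Or.inl h
    · exact Or.inr (mem_iUnion.2 ⟨⟨N, j, hj⟩, h⟩)
    · omega
  · intro y hy
    rcases hy with hy | hy
    · exact old_sub hn hD hD0 (by omega) hy
    · obtain ⟨⟨N, j, hj⟩, x, hx, rfl⟩ := mem_iUnion.1 hy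
      have hN := kk_bounds hn (D_gt hD0 hx)
      have hle := Nat.mul_le_mul_right n (show j + 1 ≤ kk n N from hj)
      rw [add_mul, one_mul] at hle
      change 1 ≤ kk n N ∧ kk n N * n + n + 1 ≤ N ∧ N ≤ kk n N * n + 2 * n at hN
      change x ∈ D N at hx
      simp only
      refine ⟨?_, ?_, ?_⟩
      · rcases Nat.eq_zero_or_pos j with rfl | h
        · exact mem_refineSet.2 (Or.inl (by simpa using (hD _ hx).1))
        · exact mem_refineSet.2 (Or.inr ⟨N, j, ⟨h, hj.le⟩, x, hx, rfl⟩)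
      · refine mem_refineSet.2 (Or.inr ⟨N, j + 1, ⟨by omega, hj⟩, x, hx, ?_⟩)
        rw [← Function.iterate_add_apply, add_mul, one_mul, add_comm]
      · intro m h1 h2 h3
        rw [← Function.iterate_add_apply] at h3
        obtain ⟨-, j', -, hj'⟩ := tower_mem hn hD hD0 (hD _ hx) (by omega) (by omega) h3
        have h1 : j < j' := by
          by_contra hcon
          have := Nat.mul_le_mul_right n (show j' ≤ j by omega)
          omega
        have := Nat.mul_le_mul_right n (show j + 1 ≤ j' from h1)
        rw [add_mul, one_mul] at this
        omega

lemma level_eq_measure {lam : Measure X} (hT : MeasurePreserving (⇑T) lam lam)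
    (hn : 1 ≤ n) (hD : ∀ N, D N ⊆ retLevel T B N) (hD0 : ∀ N, N ≤ 2 * n → D N = ∅)
    (hDm : ∀ N, MeasurableSet (D N)) :
    lam (retLevel T (refineSet T B n D) n) =
      lam (retLevel T B n) + ∑' N, (kk n N : ℝ≥0∞) * lam (D N) := by
  have hlt : ∀ (N : ℕ) (j : Fin (kk n N)), ∀ x ∈ D N, (j : ℕ) * n < N := by
    intro N j x hx
    have hN := kk_bounds hn (D_gt hD0 hx)
    have hle := Nat.mul_le_mul_right n j.2.le
    omega
  rw [level_eq hn hD hD0, measure_union, measure_iUnion]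
  · congr 1
    rw [ENNReal.tsum_sigma']
    congr 1
    ext N
    simp only [measure_iter_image T hT _ (hDm N)]
    rw [tsum_fintype]
    simp
  · rintro ⟨N, j⟩ ⟨N', j'⟩ hne
    refine Set.disjoint_left.2 ?_
    rintro _ ⟨x, hx, rfl⟩ ⟨x', hx', e⟩
    obtain ⟨rfl, h2, -⟩ := tower_unique (hD _ hx') (hD _ hx) (hlt _ _ _ hx') (hlt _ _ _ hx) e
    apply hne
    have : (j' : ℕ) = j := Nat.eq_of_mul_eq_mul_right hn h2
    have : j' = j := Fin.ext this
    rw [this]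
  · intro p
    exact measurableSet_iter_image T _ (hDm _)
  · refine Set.disjoint_left.2 ?_
    intro y hy hy'
    obtain ⟨⟨N, j⟩, x, hx, e⟩ := mem_iUnion.1 hy'
    obtain ⟨h1, -, -⟩ := tower_unique (i' := 0) (hD _ hx) hy (hlt _ _ _ hx) hn e
    have := D_gt hD0 hx
    omega
  · exact MeasurableSet.iUnion fun p => measurableSet_iter_image T _ (hDm _)

lemma level_gt {lam : Measure X} (hT : MeasurePreserving (⇑T) lam lam)
    (hn : 1 ≤ n) (hD : ∀ N, D N ⊆ retLevel T B N) (hD0 : ∀ N, N ≤ 2 * n → D N = ∅)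
    (hDm : ∀ N, MeasurableSet (D N)) {m : ℕ} (hm : n < m) :
    lam (retLevel T (refineSet T B n D) m) ≤ lam (retLevel T B m) + ∑' N, lam (D N) := by
  have : retLevel T (refineSet T B n D) m ⊆
      retLevel T B m ∪ ⋃ N, (⇑T)^[kk n N * n] '' D N := by
    intro y hy
    rcases new_sub hn hD hD0 (by omega) hy with h | h | ⟨-, -, h⟩
    · exact Or.inl h
    · omega
    · exact Or.inr (mem_iUnion.2 h)
  refine (measure_mono this).trans ((measure_union_le _ _).trans ?_)
  gcongr
  refine (measure_iUnion_le _).trans_eq ?_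
  congr 1
  ext N
  exact measure_iter_image T hT _ (hDm N)

lemma level_gt2 {lam : Measure X} 
    (hn : 1 ≤ n) (hD : ∀ N, D N ⊆ retLevel T B N) (hD0 : ∀ N, N ≤ 2 * n → D N = ∅)
    {m : ℕ} (hm : 2 * n < m) :
    lam (retLevel T (refineSet T B n D) m) ≤ lam (retLevel T B m) := by
  refine measure_mono fun y hy => ?_
  rcases new_sub hn hD hD0 (by omega) hy with h | h | h
  · exact h
  · omega
  · omega

lemma measurableSet_refineSet (hB : MeasurableSet B) (hDm : ∀ N, MeasurableSet (D N)) :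
    MeasurableSet (refineSet T B n D) :=
  hB.union (MeasurableSet.iUnion fun N => MeasurableSet.iUnion fun _ => MeasurableSet.iUnion
    fun _ => measurableSet_iter_image T _ (hDm N))

end comb

lemma step [MeasurableSpace X] [StandardBorelSpace X]
    (lam : Measure X) [NullSingletonClass lam]
    (T : X ≃ᵐ X) (hT : MeasurePreserving (⇑T) lam lam)
    (B : Set X) (hB : MeasurableSet B)
    (hinf : ∑' N : ℕ, (N : ℝ≥0∞) * lam (retLevel T B N) = ∞)
    (n : ℕ) (hn : 1 ≤ n) (L : ℕ → ℝ≥0∞) (hL : ∀ m, L m ≠ ∞)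
    (hfin : ∀ m, 1 ≤ m → lam (retLevel T B m) ≠ ∞)
    (hlt : ∀ m, n ≤ m → lam (retLevel T B m) < L m) :
    ∃ B', MeasurableSet B' ∧ B ⊆ B' ∧ (∀ m, 1 ≤ m → m < n → retLevel T B' m = retLevel T B m) ∧
      lam (retLevel T B' n) = L n ∧ ∀ m, n < m → lam (retLevel T B' m) < L m := by
  set d := L n - lam (retLevel T B n) with hd
  have hdt : d ≠ ∞ := ENNReal.sub_ne_top (hL n)
  have hev : ∀ᶠ K : ℕ in Filter.atTop, ∀ m ∈ Finset.Ioc n (2 * n),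
      lam (retLevel T B m) + d / K < L m := by
    rw [Finset.eventually_all]
    intro m hm
    have h1 : Filter.Tendsto (fun K : ℕ => lam (retLevel T B m) + d / (K : ℝ≥0∞)) Filter.atTop
        (nhds (lam (retLevel T B m) + 0)) := by
      refine Filter.Tendsto.add tendsto_const_nhds ?_
      have := ENNReal.Tendsto.const_div (a := d) ENNReal.tendsto_nat_nhds_top (Or.inr hdt)
      simpa using this
    rw [add_zero] at h1
    exact h1.eventually (gt_mem_nhds (hlt m (by simp at hm; omega)))
  obtain ⟨K, hK, hK1⟩ := (hev.and (Filter.eventually_ge_atTop 1)).exists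
  set N0 := K * n + 2 * n with hN0
  have hkN : ∀ N, N0 < N → K ≤ kk n N ∧ N ≤ 3 * n * kk n N := by
    intro N hN
    have h := kk_bounds hn (show 2 * n < N by omega)
    constructor
    · have : K * n < kk n N * n := by omega
      exact (Nat.lt_of_mul_lt_mul_right this).le
    · nlinarith [h.1, h.2.2]
  let c : ℕ → ℕ := fun N => if N ≤ N0 then 0 else kk n N
  have hsum : ∑' N, (c N : ℝ≥0∞) * lam (retLevel T B N) = ∞ := by
    by_contra hcon
    have h1 : ∑' N : ℕ, (N : ℝ≥0∞) * lam (retLevel T B N) ≤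
        ∑' N : ℕ, (if N ≤ N0 then (N : ℝ≥0∞) * lam (retLevel T B N) else 0) +
        (3 * n : ℕ) * ∑' N, (c N : ℝ≥0∞) * lam (retLevel T B N) := by
      rw [← ENNReal.tsum_mul_left, ← ENNReal.tsum_add]
      refine ENNReal.tsum_le_tsum fun N => ?_
      by_cases h : N ≤ N0
      · simp [h]
      · simp only [h, if_false, zero_add, c]
        rw [← mul_assoc]
        gcongr
        exact_mod_cast (hkN N (by omega)).2
    rw [hinf, top_le_iff] at h1
    refine ENNReal.add_ne_top.2 ⟨?_, ENNReal.mul_ne_top (ENNReal.natCast_ne_top _) hcon⟩ h1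
    rw [tsum_eq_sum (s := Finset.range (N0 + 1))]
    · refine ENNReal.sum_ne_top.2 fun N hN => ?_
      split_ifs
      · rcases Nat.eq_zero_or_pos N with rfl | h
        · simp
        · exact ENNReal.mul_ne_top (ENNReal.natCast_ne_top _) (hfin N h)
      · simp
    · intro N hN
      rw [if_neg]
      simp at hN; omega
  have htend := ENNReal.tendsto_nat_tsum (fun N => (c N : ℝ≥0∞) * lam (retLevel T B N))
  rw [hsum] at htend
  obtain ⟨M, hM⟩ := (htend.eventually (lt_mem_nhds (lt_top_iff_ne_top.2 hdt))).exists
  let ν : Measure X := ∑ N ∈ Finset.range M, (c N : ℝ≥0∞) • lam.restrict (retLevel T B N)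
  have hν : ∀ s, MeasurableSet s → ν s =
      ∑ N ∈ Finset.range M, (c N : ℝ≥0∞) * lam (s ∩ retLevel T B N) := by
    intro s hs
    simp [ν, Measure.restrict_apply hs]
  have hνu : ν univ = ∑ N ∈ Finset.range M, (c N : ℝ≥0∞) * lam (retLevel T B N) := by
    rw [hν _ MeasurableSet.univ]; simp
  have i1 : IsFiniteMeasure ν := ⟨by
    rw [hνu, lt_top_iff_ne_top]
    refine ENNReal.sum_ne_top.2 fun N hN => ?_
    rcases Nat.eq_zero_or_pos N with rfl | h
    · simp [c]
    · exact ENNReal.mul_ne_top (ENNReal.natCast_ne_top _) (hfin N h)⟩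
  have i2 : NullSingletonClass ν := ⟨fun x => by
    rw [hν _ (measurableSet_singleton x)]
    refine Finset.sum_eq_zero fun N _ => ?_
    rw [measure_mono_null inter_subset_left (measure_singleton x), mul_zero]⟩
  obtain ⟨S, hS, hSd⟩ := ivt_measure ν d (by rw [hνu]; exact hM)
  let D : ℕ → Set X := fun N => if N0 < N ∧ N < M then S ∩ retLevel T B N else ∅
  have hDm : ∀ N, MeasurableSet (D N) := by
    intro N
    simp only [D]
    split_ifs
    · exact hS.inter (measurableSet_retLevel T hB N)
    · exact MeasurableSet.empty
  have hD : ∀ N, D N ⊆ retLevel T B N := by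
    intro N
    simp only [D]
    split_ifs
    · exact inter_subset_right
    · exact empty_subset _
  have hDlow : ∀ N, N ≤ N0 → D N = ∅ := by
    intro N hN
    simp only [D]
    rw [if_neg (by omega)]
  have hD0 : ∀ N, N ≤ 2 * n → D N = ∅ := fun N hN => hDlow N (by omega)
  have hDs : ∑' N, (kk n N : ℝ≥0∞) * lam (D N) = d := by
    rw [← hSd, hν S hS, tsum_eq_sum (s := Finset.range M)]
    · refine Finset.sum_congr rfl fun N hN => ?_
      simp only [Finset.mem_range] at hN
      by_cases h : N ≤ N0
      · simp [c, h, hDlow N h]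
      · simp only [c, D, h, if_false]
        rw [if_pos ⟨by omega, hN⟩]
    · intro N hN
      simp only [Finset.mem_range] at hN
      simp only [D]
      rw [if_neg (by omega)]; simp
  have hDle : ∑' N, lam (D N) ≤ d / K := by
    rw [ENNReal.le_div_iff_mul_le (Or.inl (by simp; omega)) (Or.inl (ENNReal.natCast_ne_top _)),
      mul_comm, ← ENNReal.tsum_mul_left, ← hDs]
    refine ENNReal.tsum_le_tsum fun N => ?_
    by_cases h : N ≤ N0
    · simp [hDlow N h]
    · gcongr
      exact (hkN N (by omega)).1
  refine ⟨refineSet T B n D, measurableSet_refineSet hB hDm, subset_union_left,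
    fun m h1 h2 => level_lt hn hD hD0 h1 h2, ?_, ?_⟩
  · rw [level_eq_measure hT hn hD hD0 hDm, hDs, hd]
    exact add_tsub_cancel_of_le (hlt n le_rfl).le
  · intro m hm
    by_cases h : m ≤ 2 * n
    · refine (level_gt hT hn hD hD0 hDm hm).trans_lt (lt_of_le_of_lt ?_
        (hK m (Finset.mem_Ioc.2 ⟨hm, h⟩)))
      gcongr
    · exact (level_gt2 hn hD hD0 (by omega)).trans_lt (hlt m hm.le)

theorem iterated_return_time_expansion
    [MeasurableSpace X] [StandardBorelSpace X]
    (lam : Measure X) [SigmaFinite lam] [NullSingletonClass lam] (hX : lam univ = ∞)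
    (T : X ≃ᵐ X) (hT : MeasurePreserving (⇑T) lam lam)
    (hcons : Conserv lam T) (hap : Aperiodic lam T)
    (A : Set X) (hA : MeasurableSet A) (hAfin : lam A < ∞)
    (hAorb : ∀ᵐ x ∂lam, ∃ n : ℤ, ⇑(T.toEquiv ^ n) x ∈ A)
    (l : ℕ → ℝ)
    (hl : ∀ n, 1 ≤ n → lam (retLevel T A n) < ENNReal.ofReal (l n)) :
    ∃ B : Set X, MeasurableSet B ∧ A ⊆ B ∧
      ∀ n, 1 ≤ n → lam (retLevel T B n) = ENNReal.ofReal (l n) := by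

  let L : ℕ → ℝ≥0∞ := fun m => ENNReal.ofReal (l m)
  have hL : ∀ m, L m ≠ ∞ := fun m => ENNReal.ofReal_ne_top
  have hstep : ∀ (n : ℕ) (B : Set X), ∃ B', (MeasurableSet B ∧ A ⊆ B ∧
      (∀ m, 1 ≤ m → m ≤ n → lam (retLevel T B m) = L m) ∧
      (∀ m, n < m → lam (retLevel T B m) < L m)) →
      MeasurableSet B' ∧ B ⊆ B' ∧
      (∀ m, 1 ≤ m → m < n + 1 → retLevel T B' m = retLevel T B m) ∧
      lam (retLevel T B' (n + 1)) = L (n + 1) ∧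
      ∀ m, n + 1 < m → lam (retLevel T B' m) < L m := by
    intro n B
    by_cases h : MeasurableSet B ∧ A ⊆ B ∧
      (∀ m, 1 ≤ m → m ≤ n → lam (retLevel T B m) = L m) ∧
      (∀ m, n < m → lam (retLevel T B m) < L m)
    · obtain ⟨h1, h2, h3, h4⟩ := h
      obtain ⟨B', hB'⟩ := step lam T hT B h1
        (sum_infty lam hX T hT hcons A hA hAorb B h1 h2) (n + 1) (by omega) L hL
        (fun m hm => by
          by_cases hmn : m ≤ n
          · rw [h3 m hm hmn]; exact hL m
          · exact ((h4 m (by omega)).trans_le le_top).ne)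
        (fun m hm => h4 m hm)
      exact ⟨B', fun _ => hB'⟩
    · exact ⟨B, fun h' => absurd h' h⟩
  choose next hnext using hstep
  let sq : ℕ → Set X := fun i => Nat.rec A (fun i B => next i B) i
  have hs : ∀ i, sq (i + 1) = next i (sq i) := fun i => rfl
  have inv : ∀ i, MeasurableSet (sq i) ∧ A ⊆ sq i ∧
      (∀ m, 1 ≤ m → m ≤ i → lam (retLevel T (sq i) m) = L m) ∧
      (∀ m, i < m → lam (retLevel T (sq i) m) < L m) := by
    intro i
    induction i with
    | zero => exact ⟨hA, Subset.rfl, fun m h1 h2 => by omega, fun m hm => hl m hm⟩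
    | succ i ih =>
      obtain ⟨h1, h2, h3, h4, h5⟩ := hnext i (sq i) ih
      rw [← hs] at h1 h2 h3 h4 h5
      refine ⟨h1, ih.2.1.trans h2, fun m hm hmi => ?_, h5⟩
      rcases hmi.lt_or_eq with h | rfl
      · rw [h3 m hm h]; exact ih.2.2.1 m hm (by omega)
      · exact h4
  have hmono : Monotone sq := monotone_nat_of_le_succ fun i => (hnext i (sq i) (inv i)).2.1
  have hstab : ∀ m, 1 ≤ m → ∀ i, m ≤ i → retLevel T (sq i) m = retLevel T (sq m) m := by
    intro m hm i hi
    induction i, hi using Nat.le_induction with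
    | base => rfl
    | succ i hi ih =>
      rw [← ih]
      exact (hnext i (sq i) (inv i)).2.2.1 m hm (by omega)
  refine ⟨⋃ i, sq i, MeasurableSet.iUnion fun i => (inv i).1, subset_iUnion sq 0, fun n hn => ?_⟩
  have : retLevel T (⋃ i, sq i) n = retLevel T (sq n) n := by
    apply Subset.antisymm
    · rintro x ⟨h1, h2, h3⟩
      obtain ⟨a, ha⟩ := mem_iUnion.1 h1
      obtain ⟨b, hb⟩ := mem_iUnion.1 h2
      rw [← hstab n hn (n + a + b) (by omega)]
      exact ⟨hmono (by omega) ha, hmono (by omega) hb,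
        fun m hm hmn h => h3 m hm hmn (mem_iUnion.2 ⟨_, h⟩)⟩
    · intro x hx
      refine ⟨mem_iUnion.2 ⟨n, hx.1⟩, mem_iUnion.2 ⟨n, hx.2.1⟩, fun m hm hmn h => ?_⟩
      obtain ⟨a, ha⟩ := mem_iUnion.1 h
      rw [← hstab n hn (n + a) (by omega)] at hx
      exact hx.2.2 m hm hmn (hmono (by omega) ha)
  rw [this]
  exact (inv n).2.2.1 n hn le_rfl
end

section
/- Let (X, λ) be a standard Borel space with an atomless σ-finite measure satisfying λ(X) = ∞, and let T₁, T₂ ∈ Aut(X, λ) be conservative and aperiodic. Then for every ε > 0 there exist Borel subsets B₁ and B₂ of X such that B₁ intersects the T₁-orbit of λ-a.e. point, B₂ intersects the T₂-orbit of λ-a.e. point, λ(B₁) = λ(B₂) < ε, and for every integer n ≥ 1 one has λ(τ_{B₁,T₁}⁻¹(n)) = λ(τ_{B₂,T₂}⁻¹(n)). -/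
open MeasureTheory Set
open scoped ENNReal

variable {X : Type*}

open scoped NNReal

theorem block_exists (a : ℕ → ℝ≥0) (hs : ∑' n, (a n : ℝ≥0∞) ≠ ∞)
    (hi : ∑' n : ℕ, (n : ℝ≥0∞) * a n = ∞) (M J : ℕ) (hJ : 1 ≤ J) (q : ℝ≥0) :
    ∃ M' : ℕ, M < M' ∧ ∃ d : ℕ → ℝ≥0, (∀ n, d n ≤ a n) ∧
      ∑ n ∈ Finset.Ico M M', d n * ((n / J : ℕ) : ℝ≥0) = q := by
  have h1 : ∑' n, ((a n * ((n / J : ℕ) : ℝ≥0) : ℝ≥0) : ℝ≥0∞) = ∞ := by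
    by_contra hne
    have : ∑' n : ℕ, (n : ℝ≥0∞) * a n ≤ ∑' n, ((J : ℝ≥0∞) * ((a n * ((n / J : ℕ) : ℝ≥0) : ℝ≥0) : ℝ≥0∞) + (J : ℝ≥0∞) * a n) := by
      refine ENNReal.tsum_le_tsum fun n => ?_
      have h : n ≤ J * (n / J) + J := by
        have := Nat.div_add_mod n J
        have := Nat.mod_lt n (show 0 < J by omega)
        omega
      have h' : (n : ℝ≥0) * a n ≤ J * (a n * ((n / J : ℕ) : ℝ≥0)) + J * a n := by
        calc (n : ℝ≥0) * a n ≤ ((J * (n / J) + J : ℕ) : ℝ≥0) * a n := by gcongr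
          _ = _ := by push_cast; ring
      exact_mod_cast h'
    rw [hi, ENNReal.tsum_add, ENNReal.tsum_mul_left, ENNReal.tsum_mul_left] at this
    have h2 : (J : ℝ≥0∞) * ∑' n, ((a n * ((n / J : ℕ) : ℝ≥0) : ℝ≥0) : ℝ≥0∞) + J * ∑' n, (a n : ℝ≥0∞) < ∞ := by
      refine ENNReal.add_lt_top.2 ⟨ENNReal.mul_lt_top (by simp) (lt_top_iff_ne_top.2 hne), ENNReal.mul_lt_top (by simp) (lt_top_iff_ne_top.2 hs)⟩
    exact absurd this (not_le.2 h2)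
  have h2 : ¬ Summable (fun n => a n * ((n / J : ℕ) : ℝ≥0)) := fun h =>
    ENNReal.tsum_coe_ne_top_iff_summable.2 h h1
  have h3 := NNReal.not_summable_iff_tendsto_nat_atTop.1 h2
  obtain ⟨M', hM', hM⟩ := ((h3.eventually_ge_atTop
    (q + ∑ n ∈ Finset.range M, a n * ((n / J : ℕ) : ℝ≥0))).and (Filter.eventually_gt_atTop M)).exists
  rw [← Finset.sum_range_add_sum_Ico _ hM.le, add_comm q] at hM'
  have h4 := le_of_add_le_add_left hM'
  refine ⟨M', hM, fun n => a n * (q / ∑ n ∈ Finset.Ico M M', a n * ((n / J : ℕ) : ℝ≥0)), fun n => ?_, ?_⟩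
  · exact mul_le_of_le_one_right' (div_le_one_of_le₀ h4 (by positivity))
  · set S := ∑ n ∈ Finset.Ico M M', a n * ((n / J : ℕ) : ℝ≥0) with hS
    have : ∀ n, a n * (q / S) * ((n / J : ℕ) : ℝ≥0) = (a n * ((n / J : ℕ) : ℝ≥0)) * (q / S) := fun n => by ring
    simp_rw [this]
    rw [← Finset.sum_mul, ← hS]
    rcases eq_or_ne S 0 with h0 | h0
    · rw [h0] at h4 ⊢
      simp at h4; simp [h4]
    · field_simp

theorem tsum_blocks (f : ℕ → ℝ≥0∞) (h0 : f 0 = 0) (M : ℕ → ℕ) (hM : StrictMono M) (hM0 : M 0 = 1) :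
    ∑' n, f n = ∑' e, ∑ n ∈ Finset.Ico (M e) (M (e+1)), f n := by
  have h1 : ∀ k, ∑ e ∈ Finset.range k, ∑ n ∈ Finset.Ico (M e) (M (e+1)), f n = ∑ n ∈ Finset.range (M k), f n := by
    intro k
    induction k with
    | zero => simp [hM0, h0]
    | succ k ih => rw [Finset.sum_range_succ, ih, Finset.sum_range_add_sum_Ico _ (hM (Nat.lt_succ_self k)).le]
  have h2 := (ENNReal.tendsto_nat_tsum f).comp hM.tendsto_atTop
  have h3 := ENNReal.tendsto_nat_tsum (fun e => ∑ n ∈ Finset.Ico (M e) (M (e+1)), f n)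
  simp only [h1] at h3
  exact tendsto_nhds_unique h2 h3

/-- emission -/
noncomputable def emi (a d : ℕ → ℝ≥0) (j : ℕ → ℕ) (e : ℕ) : ℕ × ℝ≥0 :=
  if e % 2 = 0 then (max 1 (e/2), if e/2 = 0 then 0 else a (e/2) - d (e/2))
  else (max 1 ((e/2) % j (e/2)), if (e/2) % j (e/2) = 0 then 0 else d (e/2))

theorem em_pos (a d : ℕ → ℝ≥0) (j : ℕ → ℕ) (e : ℕ) : 1 ≤ (emi a d j e).1 := by
  unfold emi; split_ifs <;> simp

theorem em_congr (a d d' : ℕ → ℝ≥0) (j j' : ℕ → ℕ) (e : ℕ) (h : d (e/2) = d' (e/2)) (h' : j (e/2) = j' (e/2)) :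
    emi a d j e = emi a d' j' e := by
  unfold emi; rw [h, h']

noncomputable def emit (a d : ℕ → ℝ≥0) (j : ℕ → ℕ) (m : ℕ) : ℝ≥0∞ :=
  ∑' n, ((if n = m then ((a n - d n : ℝ≥0) : ℝ≥0∞) else 0) + (if n % j n = m then (d n : ℝ≥0∞) else 0))

noncomputable def consu (d : ℕ → ℝ≥0) (j : ℕ → ℕ) (m : ℕ) : ℝ≥0∞ :=
  ∑' n, if j n = m then (d n : ℝ≥0∞) * ((n / j n : ℕ) : ℝ≥0∞) else 0

theorem tsum_em (a d : ℕ → ℝ≥0) (j : ℕ → ℕ) (m : ℕ) (hm : 1 ≤ m) :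
    ∑' e, (if (emi a d j e).1 = m then ((emi a d j e).2 : ℝ≥0∞) else 0) = emit a d j m := by
  rw [← tsum_even_add_odd ENNReal.summable ENNReal.summable, ← ENNReal.tsum_add]
  unfold emit
  congr 1; ext n
  have e1 : (2 * n) / 2 = n := by omega
  have e2 : (2 * n + 1) / 2 = n := by omega
  have e3 : (2 * n) % 2 = 0 := by omega
  have e4 : (2 * n + 1) % 2 = 1 := by omega
  simp only [emi, e1, e2, e3, e4]
  congr 1
  · rcases Nat.eq_zero_or_pos n with h | h
    · subst h; simp; omega
    · simp [max_eq_right (show 1 ≤ n from h), h.ne']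
  · rcases Nat.eq_zero_or_pos (n % j n) with h | h
    · simp [h]; omega
    · simp [max_eq_right (show 1 ≤ n % j n from h), h.ne']

theorem cons_eq (a b d d' : ℕ → ℝ≥0) (j j' : ℕ → ℕ) (M : ℕ → ℕ) (hM : StrictMono M) (hM0 : M 0 = 1)
    (h : ∀ e, (∀ n ∈ Finset.Ico (M e) (M (e+1)), j n = (emi b d' j' e).1) ∧
      ∑ n ∈ Finset.Ico (M e) (M (e+1)), d n * ((n / (emi b d' j' e).1 : ℕ) : ℝ≥0) = (emi b d' j' e).2)
    (m : ℕ) (hm : 1 ≤ m) : consu d j m = emit b d' j' m := by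
  unfold consu
  rw [tsum_blocks _ (by simp) M hM hM0, ← tsum_em _ _ _ _ hm]
  congr 1; ext e
  obtain ⟨h1, h2⟩ := h e
  rw [← h2, Finset.sum_congr rfl (fun n hn => by rw [h1 n hn])]
  split_ifs with hh
  · push_cast; rfl
  · simp

theorem cons_total (b d d' : ℕ → ℝ≥0) (hd' : ∀ n, d' n ≤ b n) (j j' : ℕ → ℕ) (hj : ∀ n, 1 ≤ j n)
    (h : ∀ m, 1 ≤ m → consu d j m = emit b d' j' m) :
    ∑' n, (d n : ℝ≥0∞) * ((n / j n : ℕ) : ℝ≥0∞) ≤ ∑' n, (b n : ℝ≥0∞) := by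
  have h1 : ∑' n, (d n : ℝ≥0∞) * ((n / j n : ℕ) : ℝ≥0∞) = ∑' m, consu d j (m+1) := by
    unfold consu
    rw [ENNReal.tsum_comm]
    congr 1; ext n
    rw [tsum_eq_single (j n - 1)]
    · rw [if_pos (by have := hj n; omega)]
    · intro m hm; rw [if_neg (by omega)]
  rw [h1]
  calc ∑' m, consu d j (m+1) = ∑' m, emit b d' j' (m+1) := by
        congr 1; ext m; exact h _ (by omega)
    _ ≤ ∑' m, emit b d' j' m := ENNReal.tsum_comp_le_tsum_of_injective (add_left_injective 1) _
    _ = ∑' n, (b n : ℝ≥0∞) := by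
        unfold emit
        rw [ENNReal.tsum_comm]
        congr 1; ext n
        rw [ENNReal.tsum_add, tsum_ite_eq', tsum_ite_eq']
        rw [← ENNReal.coe_add, tsub_add_cancel_of_le (hd' n)]
    _ ≤ _ := le_rfl

/-- state of one side -/
structure Sd where
  M : ℕ
  d : ℕ → ℝ≥0
  j : ℕ → ℕ

noncomputable def Sd.ext' (s : Sd) (F : ℕ → ℕ × ℝ≥0 → ℕ) (G : ℕ → ℕ × ℝ≥0 → ℕ → ℝ≥0) (p : ℕ × ℝ≥0) : Sd :=
  ⟨F s.M p, fun n => if n < s.M then s.d n else G s.M p n, fun n => if n < s.M then s.j n else p.1⟩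

theorem numeric (a b : ℕ → ℝ≥0) (hsa : ∑' n, (a n : ℝ≥0∞) ≠ ∞) (hia : ∑' n : ℕ, (n : ℝ≥0∞) * a n = ∞)
    (hsb : ∑' n, (b n : ℝ≥0∞) ≠ ∞) (hib : ∑' n : ℕ, (n : ℝ≥0∞) * b n = ∞) :
    ∃ d d' : ℕ → ℝ≥0, ∃ j j' : ℕ → ℕ, (∀ n, d n ≤ a n) ∧ (∀ n, d' n ≤ b n) ∧
      (∀ n, 1 ≤ j n) ∧ (∀ n, 1 ≤ j' n) ∧
      (∀ m, 1 ≤ m → consu d j m = emit b d' j' m) ∧ (∀ m, 1 ≤ m → consu d' j' m = emit a d j m) := by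
  have key : ∀ a : ℕ → ℝ≥0, ∑' n, (a n : ℝ≥0∞) ≠ ∞ → ∑' n : ℕ, (n : ℝ≥0∞) * a n = ∞ →
    ∃ F : ℕ → ℕ × ℝ≥0 → ℕ, ∃ G : ℕ → ℕ × ℝ≥0 → ℕ → ℝ≥0, ∀ M p, M < F M p ∧ (∀ n, G M p n ≤ a n) ∧
      (1 ≤ p.1 → ∑ n ∈ Finset.Ico M (F M p), G M p n * ((n / p.1 : ℕ) : ℝ≥0) = p.2) := by
    intro a hs hi
    have : ∀ M (p : ℕ × ℝ≥0), ∃ M' : ℕ, ∃ d : ℕ → ℝ≥0, M < M' ∧ (∀ n, d n ≤ a n) ∧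
      (1 ≤ p.1 → ∑ n ∈ Finset.Ico M M', d n * ((n / p.1 : ℕ) : ℝ≥0) = p.2) := by
      intro M p
      by_cases hp : 1 ≤ p.1
      · obtain ⟨M', h1, d, h2, h3⟩ := block_exists a hs hi M p.1 hp p.2
        exact ⟨M', d, h1, h2, fun _ => h3⟩
      · exact ⟨M+1, 0, by omega, by simp, fun h => absurd h hp⟩
    choose F G h using this
    exact ⟨F, G, h⟩
  obtain ⟨F, G, hF⟩ := key a hsa hia
  obtain ⟨F', G', hF'⟩ := key b hsb hib
  let S : ℕ → Sd × Sd := fun e => Nat.rec (⟨1, 0, 1⟩, ⟨1, 0, 1⟩)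
    (fun e s => (s.1.ext' F G (emi b s.2.d s.2.j e), s.2.ext' F' G' (emi a s.1.d s.1.j e))) e
  have hS : ∀ e, S (e+1) = ((S e).1.ext' F G (emi b (S e).2.d (S e).2.j e),
      (S e).2.ext' F' G' (emi a (S e).1.d (S e).1.j e)) := fun e => rfl
  -- generic side lemma
  have side : ∀ (a : ℕ → ℝ≥0) (F : ℕ → ℕ × ℝ≥0 → ℕ) (G : ℕ → ℕ × ℝ≥0 → ℕ → ℝ≥0)
      (_ : ∀ M p, M < F M p ∧ (∀ n, G M p n ≤ a n) ∧
        (1 ≤ p.1 → ∑ n ∈ Finset.Ico M (F M p), G M p n * ((n / p.1 : ℕ) : ℝ≥0) = p.2))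
      (s : ℕ → Sd) (p : ℕ → ℕ × ℝ≥0) (_ : ∀ e, 1 ≤ (p e).1) (_ : s 0 = ⟨1, 0, 1⟩)
      (_ : ∀ e, s (e+1) = (s e).ext' F G (p e)),
      StrictMono (fun e => (s e).M) ∧ (∀ e, e < (s e).M) ∧
      (∀ e n, (s e).d n ≤ a n) ∧ (∀ e n, 1 ≤ (s e).j n) ∧
      (∀ e n, n < (s e).M → (s e).d n = (s n).d n ∧ (s e).j n = (s n).j n) ∧
      (∀ e, (∀ n ∈ Finset.Ico (s e).M (s (e+1)).M, (s n).j n = (p e).1) ∧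
        ∑ n ∈ Finset.Ico (s e).M (s (e+1)).M, (s n).d n * ((n / (p e).1 : ℕ) : ℝ≥0) = (p e).2) := by
    intro a F G hF s p hp s0 hs
    have hmono : StrictMono (fun e => (s e).M) := by
      refine strictMono_nat_of_lt_succ fun e => ?_
      rw [hs e]; exact (hF _ _).1
    have hlt : ∀ e, e < (s e).M := by
      intro e
      induction e with
      | zero => rw [s0]; simp
      | succ e ih => have := hmono (Nat.lt_succ_self e); simp only [Nat.succ_eq_add_one] at this; omega
    have hstab : ∀ e k n, n < (s e).M → (s (e+k)).d n = (s e).d n ∧ (s (e+k)).j n = (s e).j n := by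
      intro e k n hn
      induction k with
      | zero => simp
      | succ k ih =>
        have h1 : n < (s (e+k)).M := lt_of_lt_of_le hn (hmono.monotone (by omega))
        rw [← ih.1, ← ih.2, ← add_assoc, hs (e+k)]
        simp [Sd.ext', h1]
    have hst : ∀ e n, n < (s e).M → (s e).d n = (s n).d n ∧ (s e).j n = (s n).j n := by
      intro e n hn
      rcases le_total e n with h | h
      · obtain ⟨k, rfl⟩ := Nat.exists_eq_add_of_le h
        have := hstab e k _ hn
        exact ⟨this.1.symm, this.2.symm⟩
      · obtain ⟨k, rfl⟩ := Nat.exists_eq_add_of_le h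
        exact hstab n k n (hlt n)
    refine ⟨hmono, hlt, ?_, ?_, hst, ?_⟩
    · intro e
      induction e with
      | zero => rw [s0]; simp
      | succ e ih =>
        intro n; rw [hs]; simp only [Sd.ext']
        split_ifs
        · exact ih n
        · exact (hF _ _).2.1 n
    · intro e
      induction e with
      | zero => rw [s0]; simp
      | succ e ih =>
        intro n; rw [hs]; simp only [Sd.ext']
        split_ifs
        · exact ih n
        · exact hp e
    · intro e
      have hv : ∀ n ∈ Finset.Ico (s e).M (s (e+1)).M, (s n).j n = (p e).1 ∧ (s n).d n = G (s e).M (p e) n := by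
        intro n hn
        rw [Finset.mem_Ico] at hn
        have := hst (e+1) n hn.2
        rw [← this.1, ← this.2, hs]
        simp [Sd.ext', hn.1]
      refine ⟨fun n hn => (hv n hn).1, ?_⟩
      rw [Finset.sum_congr rfl (fun n hn => by rw [(hv n hn).2])]
      have := (hF (s e).M (p e)).2.2 (hp e)
      rw [hs]; exact this
  obtain ⟨m1, l1, d1, j1, t1, b1⟩ := side a F G hF (fun e => (S e).1) _ (fun e => em_pos _ _ _ _) rfl (fun e => congrArg Prod.fst (hS e))
  obtain ⟨m2, l2, d2, j2, t2, b2⟩ := side b F' G' hF' (fun e => (S e).2) _ (fun e => em_pos _ _ _ _) rfl (fun e => congrArg Prod.snd (hS e))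
  refine ⟨fun n => (S n).1.d n, fun n => (S n).2.d n, fun n => (S n).1.j n, fun n => (S n).2.j n,
    fun n => d1 n n, fun n => d2 n n, fun n => j1 n n, fun n => j2 n n, ?_, ?_⟩
  · refine cons_eq a b _ _ _ _ _ m1 rfl ?_
    intro e
    have h := t2 e (e/2) (lt_of_le_of_lt (Nat.div_le_self _ _) (l2 e))
    rw [← em_congr b (S e).2.d (fun n => (S n).2.d n) (S e).2.j (fun n => (S n).2.j n) e h.1 h.2]
    exact b1 e
  · refine cons_eq b a _ _ _ _ _ m2 rfl ?_
    intro e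
    have h := t1 e (e/2) (lt_of_le_of_lt (Nat.div_le_self _ _) (l1 e))
    rw [← em_congr a (S e).1.d (fun n => (S n).1.d n) (S e).1.j (fun n => (S n).1.j n) e h.1 h.2]
    exact b2 e

section Erg
variable [MeasurableSpace X]

theorem exists_subset_measure (lam : Measure X) [StandardBorelSpace X] [NullSingletonClass lam]
    (E : Set X) (hE : MeasurableSet E) (hfin : lam E ≠ ∞) (d : NNReal) (hd : (d : ℝ≥0∞) ≤ lam E) :
    ∃ D ⊆ E, MeasurableSet D ∧ lam D = d := by
  rcases eq_or_ne d 0 with h0 | h0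
  · exact ⟨∅, empty_subset _, MeasurableSet.empty, by simp [h0]⟩
  rcases hd.eq_or_lt with h1 | h1
  · exact ⟨E, subset_rfl, hE, h1.symm⟩
  obtain ⟨f, hf⟩ := exists_measurableEmbedding_real X
  have : IsFiniteMeasure (lam.restrict E) := ⟨by simpa using lt_top_iff_ne_top.2 hfin⟩
  set ν := (lam.restrict E).map f with hν
  have hap : ∀ s, MeasurableSet s → ν s = lam (f ⁻¹' s ∩ E) := fun s hs => by
    rw [hν, Measure.map_apply hf.measurable hs, Measure.restrict_apply (hf.measurable hs)]
  have : NullSingletonClass ν := ⟨fun x => by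
    rw [hap _ (measurableSet_singleton x)]
    refine measure_mono_null inter_subset_left ?_
    exact Set.Subsingleton.measure_zero (subsingleton_singleton.preimage hf.injective) _⟩
  have : IsFiniteMeasure ν := by rw [hν]; infer_instance
  have huniv : ν univ = lam E := by rw [hap _ MeasurableSet.univ]; simp
  obtain ⟨b, hb⟩ := ((tendsto_measure_Iic_atTop ν).eventually (lt_mem_nhds (huniv ▸ h1))).exists
  obtain ⟨c, hc⟩ := ((tendsto_measure_Ici_atBot ν).eventually
    (lt_mem_nhds (a := ν univ - d) (b := ν univ) (by
      refine ENNReal.sub_lt_self (by simp) ?_ (by simpa using h0)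
      rw [huniv]; exact (lt_of_le_of_lt zero_le h1).ne'))).exists
  have hc' : ν (Iic c) < d := by
    have e1 : ν (Iic c) = ν (Iio c) := (measure_congr Iio_ae_eq_Iic).symm
    have e2 : ν (Iio c) + ν (Ici c) = ν univ := by
      rw [← measure_union (by simp [Set.disjoint_left]) measurableSet_Ici, Iio_union_Ici]
    rw [e1]
    by_contra hcon
    push Not at hcon
    have h3 : ν univ - d < ν univ - ν (Iio c) := by
      rwa [← e2, ENNReal.add_sub_cancel_left (measure_ne_top _ _), e2]
    exact absurd h3 (not_lt.2 (tsub_le_tsub_left hcon _))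
  have hcb : c ≤ b := by
    by_contra hcon
    exact absurd (hb.trans_le (measure_mono (Iic_subset_Iic.2 (not_le.1 hcon).le))) (not_lt.2 hc'.le)
  have hcont : ContinuousOn (fun t => ν.real (Iic t)) (Icc c b) := by
    have := IntegrableOn.continuousOn_Iic_primitive_Iic (μ := ν) (a₀ := b) (f := fun _ => (1 : ℝ)) (by simp)
    refine (this.congr ?_).mono Icc_subset_Iic_self
    intro t _
    simp
  have hmem : (d : ℝ) ∈ Icc (ν.real (Iic c)) (ν.real (Iic b)) := by
    constructor
    · have := ENNReal.toReal_mono (by simp) hc'.le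
      simpa [Measure.real] using this
    · have := ENNReal.toReal_mono (by simp) hb.le
      simpa [Measure.real] using this
  obtain ⟨t, -, ht⟩ := intermediate_value_Icc hcb hcont hmem
  refine ⟨f ⁻¹' Iic t ∩ E, inter_subset_right, (hf.measurable measurableSet_Iic).inter hE, ?_⟩
  rw [← hap _ measurableSet_Iic]
  have : (ν (Iic t)).toReal = ((d : ℝ≥0∞)).toReal := by simpa [Measure.real] using ht
  exact (ENNReal.toReal_eq_toReal_iff' (by simp) (by simp)).1 this

variable {lam : Measure X} {T : X ≃ᵐ X}

theorem iter_meas (T : X ≃ᵐ X) (n : ℕ) : Measurable ((⇑T)^[n]) := T.measurable.iterate n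

theorem retLevel_meas {B : Set X} (hB : MeasurableSet B) (n : ℕ) : MeasurableSet (retLevel T B n) := by
  have : retLevel T B n = B ∩ ((⇑T)^[n] ⁻¹' B ∩ ⋂ m : ℕ, ⋂ _ : 1 ≤ m, ⋂ _ : m < n, ((⇑T)^[m] ⁻¹' B)ᶜ) := by
    ext x; simp [retLevel]; tauto
  rw [this]
  refine hB.inter ((iter_meas T n hB).inter ?_)
  exact MeasurableSet.iInter fun m => MeasurableSet.iInter fun _ => MeasurableSet.iInter fun _ =>
    (iter_meas T m hB).compl

theorem ae_iter (hT : MeasurePreserving (⇑T) lam lam) {P : X → Prop} (h : ∀ᵐ x ∂lam, P x) :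
    ∀ᵐ x ∂lam, ∀ n, P ((⇑T)^[n] x) :=
  ae_all_iff.2 fun n => (hT.iterate n).quasiMeasurePreserving.ae h

theorem wandering (hc : Conserv lam T) (W : Set X) (hW : MeasurableSet W)
    (h : ∀ x ∈ W, ∀ n, 1 ≤ n → (⇑T)^[n] x ∉ W) : lam W = 0 := by
  by_contra hne
  have h1 := hc W hW (pos_iff_ne_zero.2 hne)
  apply hne
  refine measure_mono_null ?_ h1
  intro x hx hx'
  obtain ⟨n, hn, hn'⟩ := hx' hx
  exact h x hx n hn hn'

theorem ret_ae (hc : Conserv lam T) {B : Set X} (hB : MeasurableSet B) :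
    ∀ᵐ x ∂lam, x ∈ B → ∃ n : ℕ, 1 ≤ n ∧ (⇑T)^[n] x ∈ B := by
  rcases eq_or_ne (lam B) 0 with h | h
  · filter_upwards [measure_eq_zero_iff_ae_notMem.1 h] with x hx hx'
    exact absurd hx' hx
  · exact hc B hB (pos_iff_ne_zero.2 h)

theorem first_ret {B : Set X} {x : X} (hx : x ∈ B) {k : ℕ} (hk : 1 ≤ k) (h : (⇑T)^[k] x ∈ B) :
    ∃ r, 1 ≤ r ∧ r ≤ k ∧ x ∈ retLevel T B r := by
  classical
  have hex : ∃ r, 1 ≤ r ∧ (⇑T)^[r] x ∈ B := ⟨k, hk, h⟩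
  refine ⟨Nat.find hex, (Nat.find_spec hex).1, Nat.find_min' hex ⟨hk, h⟩, hx, (Nat.find_spec hex).2, ?_⟩
  intro m hm hlt hmB
  exact Nat.find_min hex hlt ⟨hm, hmB⟩

theorem ret_uniq {B : Set X} {x : X} {n n' : ℕ} (hn : 1 ≤ n) (hn' : 1 ≤ n')
    (h : x ∈ retLevel T B n) (h' : x ∈ retLevel T B n') : n = n' := by
  rcases lt_trichotomy n n' with hl | hl | hl
  · exact absurd h.2.1 (h'.2.2 n hn hl)
  · exact hl
  · exact absurd h'.2.1 (h.2.2 n' hn' hl)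

theorem col_uniq_aux {B : Set X} {x y : X} {n t s : ℕ}
    (h : x ∈ retLevel T B n) (h' : y ∈ B) (ht : t < n) (hst : s ≤ t)
    (he : (⇑T)^[t] x = (⇑T)^[s] y) : t = s ∧ x = y := by
  obtain ⟨k, rfl⟩ := Nat.exists_eq_add_of_le hst
  rw [Function.iterate_add_apply] at he
  have he' := T.injective.iterate s he
  rcases Nat.eq_zero_or_pos k with h0 | h0
  · subst h0; exact ⟨rfl, he'⟩
  · exact absurd (he' ▸ h') (h.2.2 k h0 (by omega))

theorem col_uniq {B : Set X} {x y : X} {n n' t s : ℕ}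
    (h : x ∈ retLevel T B n) (h' : y ∈ retLevel T B n') (ht : t < n) (hs : s < n')
    (he : (⇑T)^[t] x = (⇑T)^[s] y) : t = s ∧ x = y := by
  rcases le_total s t with hl | hl
  · exact col_uniq_aux h h'.1 ht hl he
  · have := col_uniq_aux h' h.1 hs hl he.symm
    exact ⟨this.1.symm, this.2.symm⟩

theorem measure_eq_ret (hc : Conserv lam T) {B : Set X} (hB : MeasurableSet B) :
    lam B = ∑' n, lam (retLevel T B (n+1)) := by
  rw [← measure_iUnion]
  · refine measure_congr ?_
    filter_upwards [ret_ae hc hB] with x hx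
    refine propext ⟨fun h => ?_, fun h => ?_⟩
    · obtain ⟨k, hk, hk'⟩ := hx h
      obtain ⟨r, hr, -, hr'⟩ := first_ret h hk hk'
      refine mem_iUnion.2 ⟨r - 1, ?_⟩
      rwa [Nat.sub_add_cancel hr]
    · obtain ⟨n, hn⟩ := mem_iUnion.1 h
      exact hn.1
  · intro i k hik
    refine Set.disjoint_left.2 fun x hx hx' => hik ?_
    have := ret_uniq (by omega) (by omega) hx hx'
    omega
  · exact fun n => retLevel_meas hB _

def upSet (T : X ≃ᵐ X) (A : Set X) (f : X → ℝ) : Set X :=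
  ⋃ n : ℕ, retLevel T A (n+1) ∩ {x | f x < f ((⇑T)^[n+1] x)}

theorem upSet_meas {A : Set X} (hA : MeasurableSet A) {f : X → ℝ} (hf : Measurable f) :
    MeasurableSet (upSet T A f) :=
  MeasurableSet.iUnion fun n => (retLevel_meas hA _).inter
    (measurableSet_lt hf (hf.comp (iter_meas T _)))

theorem upSet_hit (hc : Conserv lam T) (hap : Aperiodic lam T)
    {A : Set X} (hA : MeasurableSet A) {f : X → ℝ} (hf : Measurable f) (hinj : Function.Injective f) :
    ∀ᵐ x ∂lam, x ∈ A → ∃ n : ℕ, (⇑T)^[n] x ∈ upSet T A f := by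
  set U := upSet T A f with hU
  have hUm : MeasurableSet U := upSet_meas hA hf
  have desc : ∀ (q : ℝ) (k : ℕ) (y : X), (∀ i, (⇑T)^[i] y ∉ U) → y ∈ A → f y ≤ q →
      (⇑T)^[k] y ∈ A → f ((⇑T)^[k] y) ≤ q := by
    intro q k
    induction k using Nat.strong_induction_on with
    | _ k ih =>
      intro y hy hyA hyq hk
      rcases Nat.eq_zero_or_pos k with h0 | h0
      · subst h0; exact hyq
      obtain ⟨r, hr, hrk, hrr⟩ := first_ret hyA h0 hk
      obtain ⟨l, rfl⟩ := Nat.exists_eq_add_of_le hrk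
      have h1 : f ((⇑T)^[r] y) ≤ f y := by
        by_contra hcon
        apply hy 0
        refine mem_iUnion.2 ⟨r - 1, ?_⟩
        rw [Nat.sub_add_cancel hr]
        exact ⟨hrr, not_le.1 hcon⟩
      rw [add_comm, Function.iterate_add_apply] at hk ⊢
      refine ih l (by omega) _ ?_ hrr.2.1 (h1.trans hyq) hk
      intro i
      rw [← Function.iterate_add_apply]
      exact hy _
  let W : ℚ → Set X := fun q => (⋃ n : ℕ, retLevel T A (n+1) ∩ {x | f ((⇑T)^[n+1] x) ≤ q}) ∩
    {x | (q : ℝ) < f x} ∩ ⋂ i : ℕ, ((⇑T)^[i] ⁻¹' U)ᶜ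
  have hW : ∀ q, lam (W q) = 0 := by
    intro q
    refine wandering hc _ ?_ ?_
    · refine (MeasurableSet.inter (MeasurableSet.iUnion fun n => (retLevel_meas hA _).inter
        (measurableSet_le (hf.comp (iter_meas T _)) measurable_const))
        (measurableSet_lt measurable_const hf)).inter (MeasurableSet.iInter fun i => (iter_meas T i hUm).compl)
    · rintro x ⟨⟨hx1, hx2⟩, hx3⟩ n hn ⟨⟨hy1, hy2⟩, hy3⟩
      obtain ⟨r, hr, hr'⟩ := mem_iUnion.1 hx1
      obtain ⟨r2, hr2, -⟩ := mem_iUnion.1 hy1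
      have hle : r + 1 ≤ n := by
        by_contra hcon
        exact hr.2.2 n hn (by omega) hr2.1
      obtain ⟨l, rfl⟩ := Nat.exists_eq_add_of_le hle
      have hx3' : ∀ i, (⇑T)^[i] x ∉ U := fun i => mem_iInter.1 hx3 i
      have hmem := hr2.1
      simp only [mem_ofPred_eq] at hy2
      rw [add_comm, Function.iterate_add_apply] at hmem hy2
      have := desc q l ((⇑T)^[r+1] x) (fun i => by rw [← Function.iterate_add_apply]; exact hx3' _)
        hr.2.1 hr' hmem
      exact absurd this (not_le.2 hy2)
  have hW' : ∀ᵐ x ∂lam, ∀ q, x ∉ W q := ae_all_iff.2 fun q => measure_eq_zero_iff_ae_notMem.1 (hW q)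
  filter_upwards [ret_ae hc hA, hap, hW'] with x h1 h2 h3 hxA
  by_contra hcon
  push Not at hcon
  obtain ⟨k, hk, hk'⟩ := h1 hxA
  obtain ⟨r, hr, -, hrr⟩ := first_ret hxA hk hk'
  have hle : f ((⇑T)^[r] x) ≤ f x := by
    by_contra hc2
    apply hcon 0
    refine mem_iUnion.2 ⟨r - 1, ?_⟩
    rw [Nat.sub_add_cancel hr]
    exact ⟨hrr, not_le.1 hc2⟩
  have hlt : f ((⇑T)^[r] x) < f x := lt_of_le_of_ne hle fun h => h2 r hr (hinj h)
  obtain ⟨q, hq1, hq2⟩ := exists_rat_btwn hlt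
  refine h3 q ⟨⟨mem_iUnion.2 ⟨r - 1, ?_⟩, hq2⟩, mem_iInter.2 fun i => hcon i⟩
  rw [Nat.sub_add_cancel hr]
  exact ⟨hrr, hq1.le⟩

theorem halve [StandardBorelSpace X] (hc : Conserv lam T) (hap : Aperiodic lam T)
    {A : Set X} (hA : MeasurableSet A) :
    ∃ A', MeasurableSet A' ∧ lam A' ≤ lam A * 2⁻¹ ∧ ∀ᵐ x ∂lam, x ∈ A → ∃ n : ℕ, (⇑T)^[n] x ∈ A' := by
  obtain ⟨f, hf⟩ := exists_measurableEmbedding_real X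
  have hg : Measurable (fun x => - f x) := hf.measurable.neg
  have hginj : Function.Injective (fun x => - f x) := fun x y h => hf.injective (neg_injective h)
  have hdis : Disjoint (upSet T A f) (upSet T A (fun x => - f x)) := by
    refine Set.disjoint_left.2 fun x hx hy => ?_
    obtain ⟨n, hn, hn'⟩ := mem_iUnion.1 hx
    obtain ⟨m, hm, hm'⟩ := mem_iUnion.1 hy
    have := ret_uniq (by omega) (by omega) hn hm
    rw [← this] at hm'
    simp only [mem_ofPred_eq] at hn' hm'
    linarith
  have hsub : ∀ g : X → ℝ, upSet T A g ⊆ A := fun g x hx => by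
    obtain ⟨n, hn, -⟩ := mem_iUnion.1 hx
    exact hn.1
  have hle : lam (upSet T A f) + lam (upSet T A (fun x => - f x)) ≤ lam A := by
    rw [← measure_union hdis (upSet_meas hA hg)]
    exact measure_mono (union_subset (hsub _) (hsub _))
  have hor : lam (upSet T A f) ≤ lam A * 2⁻¹ ∨ lam (upSet T A (fun x => - f x)) ≤ lam A * 2⁻¹ := by
    by_contra hcon
    push Not at hcon
    have := ENNReal.add_lt_add hcon.1 hcon.2
    rw [← mul_add, ENNReal.inv_two_add_inv_two, mul_one] at this
    exact absurd hle (not_le.2 this)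
  rcases hor with h | h
  · exact ⟨_, upSet_meas hA hf.measurable, h, upSet_hit hc hap hA hf.measurable hf.injective⟩
  · exact ⟨_, upSet_meas hA hg, h, upSet_hit hc hap hA hg hginj⟩

theorem small_hit [StandardBorelSpace X] (hT : MeasurePreserving (⇑T) lam lam)
    (hc : Conserv lam T) (hap : Aperiodic lam T)
    {Y : Set X} (hY : MeasurableSet Y) (hfin : lam Y ≠ ∞) {δ : ℝ≥0∞} (hδ : 0 < δ) :
    ∃ A, MeasurableSet A ∧ lam A < δ ∧ ∀ᵐ x ∂lam, x ∈ Y → ∃ n : ℕ, (⇑T)^[n] x ∈ A := by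
  have hk : ∀ k : ℕ, ∃ A, MeasurableSet A ∧ lam A ≤ lam Y * 2⁻¹ ^ k ∧
      ∀ᵐ x ∂lam, x ∈ Y → ∃ n : ℕ, (⇑T)^[n] x ∈ A := by
    intro k
    induction k with
    | zero => exact ⟨Y, hY, by simp, ae_of_all _ fun x hx => ⟨0, hx⟩⟩
    | succ k ih =>
      obtain ⟨A, hA, hle, hh⟩ := ih
      obtain ⟨A', hA', hle', hh'⟩ := halve hc hap hA
      refine ⟨A', hA', ?_, ?_⟩
      · calc lam A' ≤ lam A * 2⁻¹ := hle'
          _ ≤ (lam Y * 2⁻¹ ^ k) * 2⁻¹ := by gcongr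
          _ = _ := by rw [pow_succ, mul_assoc]
      · filter_upwards [hh, ae_iter hT hh'] with x h1 h2 hx
        obtain ⟨n, hn⟩ := h1 hx
        obtain ⟨m, hm⟩ := h2 n hn
        exact ⟨m + n, by rwa [Function.iterate_add_apply]⟩
  have ht : Filter.Tendsto (fun k : ℕ => lam Y * (2⁻¹ : ℝ≥0∞) ^ k) Filter.atTop (nhds (lam Y * 0)) :=
    ENNReal.Tendsto.const_mul (ENNReal.tendsto_pow_atTop_nhds_zero_of_lt_one (by simp)) (Or.inr hfin)
  rw [mul_zero] at ht
  obtain ⟨k, hk'⟩ := (ht.eventually (gt_mem_nhds hδ)).exists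
  obtain ⟨A, hA, hle, hh⟩ := hk k
  exact ⟨A, hA, hle.trans_lt hk', hh⟩

theorem small_section [StandardBorelSpace X] [SigmaFinite lam] (hT : MeasurePreserving (⇑T) lam lam)
    (hc : Conserv lam T) (hap : Aperiodic lam T) {ε : ℝ≥0∞} (hε : 0 < ε) :
    ∃ A, MeasurableSet A ∧ lam A < ε ∧ ∀ᵐ x ∂lam, ∃ n : ℕ, (⇑T)^[n] x ∈ A := by
  obtain ⟨δ, hδ, hsum⟩ := ENNReal.exists_pos_sum_of_countable' hε.ne' ℕ
  have := fun i => small_hit hT hc hap (measurableSet_spanningSets lam i)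
    (measure_spanningSets_lt_top lam i).ne (hδ i)
  choose A hA hlt hh using this
  refine ⟨⋃ i, A i, MeasurableSet.iUnion hA, ?_, ?_⟩
  · exact (measure_iUnion_le _).trans_lt ((ENNReal.tsum_le_tsum fun i => (hlt i).le).trans_lt hsum)
  · filter_upwards [ae_all_iff.2 hh] with x hx
    obtain ⟨i, hi⟩ := mem_iUnion.1 ((iUnion_spanningSets lam).symm ▸ mem_univ x : x ∈ ⋃ i, spanningSets lam i)
    obtain ⟨n, hn⟩ := hx i hi
    exact ⟨n, mem_iUnion.2 ⟨i, hn⟩⟩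

theorem back_hit (hT : MeasurePreserving (⇑T) lam lam) (hc : Conserv lam T) {A : Set X}
    (hA : MeasurableSet A) (hh : ∀ᵐ x ∂lam, ∃ n : ℕ, (⇑T)^[n] x ∈ A) :
    ∀ᵐ x ∂lam, ∃ n : ℕ, (⇑T.symm)^[n] x ∈ A := by
  set E : Set X := ⋂ n : ℕ, ((⇑T.symm)^[n] ⁻¹' A)ᶜ with hE
  have hEm : MeasurableSet E := MeasurableSet.iInter fun n => (iter_meas T.symm n hA).compl
  have hEmem : ∀ x, x ∈ E ↔ ∀ n, (⇑T.symm)^[n] x ∉ A := fun x => by simp [hE]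
  have hEk : ∀ k x, (⇑T)^[k] x ∈ E → x ∈ E := by
    intro k x h
    rw [hEmem] at h ⊢
    intro n
    have := h (n + k)
    rw [Function.iterate_add_apply, show (⇑T.symm)^[k] ((⇑T)^[k] x) = x from
      (T.left_inv.iterate k : Function.LeftInverse _ _) x] at this
    exact this
  have hW : lam (E ∩ (⇑T) ⁻¹' Eᶜ) = 0 := by
    refine wandering hc _ (hEm.inter (T.measurable hEm.compl)) ?_
    rintro x ⟨hx, hx'⟩ n hn ⟨hy, -⟩
    obtain ⟨m, rfl⟩ := Nat.exists_eq_add_of_le' hn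
    rw [Function.iterate_succ_apply] at hy
    exact hx' (hEk m _ hy)
  filter_upwards [hh, ae_iter hT (measure_eq_zero_iff_ae_notMem.1 hW)] with x ⟨n, hn⟩ h2
  by_contra hcon
  push Not at hcon
  have hx : x ∈ E := (hEmem x).2 hcon
  have : ∀ k, (⇑T)^[k] x ∈ E := by
    intro k
    induction k with
    | zero => exact hx
    | succ k ih =>
      by_contra h
      rw [Function.iterate_succ_apply'] at h
      exact h2 k ⟨ih, h⟩
  exact (hEmem _).1 (this n) 0 hn

theorem decomp (hT : MeasurePreserving (⇑T) lam lam) (hc : Conserv lam T) {A : Set X}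
    (hA : MeasurableSet A) (hh : ∀ᵐ x ∂lam, ∃ n : ℕ, (⇑T)^[n] x ∈ A) {E : Set X} (hE : MeasurableSet E) :
    lam E = ∑' n : ℕ, ∑ t ∈ Finset.range n, lam (retLevel T A n ∩ (⇑T)^[t] ⁻¹' E) := by
  classical
  have hTs : MeasurePreserving (⇑T.symm) lam lam := hT.symm T
  have hli : ∀ t x, (⇑T.symm)^[t] ((⇑T)^[t] x) = x := fun t x =>
    (T.left_inv.iterate t : Function.LeftInverse _ _) x
  have hri : ∀ t x, (⇑T)^[t] ((⇑T.symm)^[t] x) = x := fun t x =>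
    (T.right_inv.iterate t : Function.LeftInverse _ _) x
  let Q : ℕ × ℕ → Set X := fun p => if p.2 < p.1 then (⇑T.symm)^[p.2] ⁻¹' (retLevel T A p.1) ∩ E else ∅
  have hQm : ∀ p, MeasurableSet (Q p) := by
    intro p; simp only [Q]; split_ifs
    · exact (iter_meas T.symm _ (retLevel_meas hA _)).inter hE
    · exact MeasurableSet.empty
  have hQd : Pairwise (Function.onFun Disjoint Q) := by
    rintro ⟨n, t⟩ ⟨m, s⟩ hne
    refine Set.disjoint_left.2 fun x hx hy => hne ?_
    simp only [Q] at hx hy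
    split_ifs at hx with h1
    · split_ifs at hy with h2
      · have := col_uniq (x := (⇑T.symm)^[t] x) (y := (⇑T.symm)^[s] x) hx.1 hy.1 h1 h2 (by rw [hri, hri])
        have h3 := hx.1
        have h4 := hy.1
        simp only [mem_preimage] at h3 h4
        rw [← this.2] at h4
        have h5 := ret_uniq (by omega) (by omega) h3 h4
        rw [this.1, h5]
      · exact absurd hy (by simp)
    · exact absurd hx (by simp)
  have hcov : lam E = lam (⋃ p, Q p) := by
    refine measure_congr ?_
    filter_upwards [back_hit hT hc hA hh, ae_iter (T := T.symm) hTs (ret_ae hc hA)] with x hx hx2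
    refine propext ⟨fun h => ?_, fun h => ?_⟩
    · let t := Nat.find hx
      have ht : (⇑T.symm)^[t] x ∈ A := Nat.find_spec hx
      obtain ⟨k, hk, hk'⟩ := hx2 t ht
      obtain ⟨r, hr, -, hr'⟩ := first_ret ht hk hk'
      have htr : t < r := by
        by_contra hcon
        push Not at hcon
        obtain ⟨l, hl⟩ := Nat.exists_eq_add_of_le hcon
        have h3 := hr'.2.1
        rw [hl, Function.iterate_add_apply, hri] at h3
        exact Nat.find_min hx (show l < t by omega) h3
      refine mem_iUnion.2 ⟨(r, t), ?_⟩
      simp only [Q, if_pos htr]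
      exact ⟨hr', h⟩
    · obtain ⟨p, hp⟩ := mem_iUnion.1 h
      simp only [Q] at hp
      split_ifs at hp
      · exact hp.2
      · exact absurd hp (by simp)
  rw [hcov, measure_iUnion hQd hQm, ENNReal.tsum_prod']
  congr 1; ext n
  rw [tsum_eq_sum (s := Finset.range n)]
  · refine Finset.sum_congr rfl fun t ht => ?_
    rw [Finset.mem_range] at ht
    rw [← (hT.iterate t).measure_preimage (hQm _).nullMeasurableSet]
    congr 1
    ext x
    simp [Q, ht, hli]
  · intro t ht
    rw [Finset.mem_range] at ht
    simp [Q, ht]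

/-- the refined section -/
def refSec (T : X ≃ᵐ X) (A : Set X) (D : ℕ → Set X) (j : ℕ → ℕ) : Set X :=
  A ∪ ⋃ n : ℕ, ⋃ t : ℕ, ⋃ _ : t < n ∧ j n ∣ t, (⇑T.symm)^[t] ⁻¹' (D n)

theorem refSec_meas {A : Set X} (hA : MeasurableSet A) {D : ℕ → Set X} (hD : ∀ n, MeasurableSet (D n))
    (j : ℕ → ℕ) : MeasurableSet (refSec T A D j) :=
  hA.union (MeasurableSet.iUnion fun n => MeasurableSet.iUnion fun t => MeasurableSet.iUnion fun _ =>
    iter_meas T.symm t (hD n))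

theorem refSec_iff {A : Set X} {D : ℕ → Set X} (hD : ∀ n, D n ⊆ retLevel T A n) (j : ℕ → ℕ)
    {n t : ℕ} (ht : t < n) {x : X} (hx : x ∈ retLevel T A n) :
    (⇑T)^[t] x ∈ refSec T A D j ↔ t = 0 ∨ (x ∈ D n ∧ j n ∣ t) := by
  have hli : ∀ t x, (⇑T.symm)^[t] ((⇑T)^[t] x) = x := fun t x =>
    (T.left_inv.iterate t : Function.LeftInverse _ _) x
  have hri : ∀ t x, (⇑T)^[t] ((⇑T.symm)^[t] x) = x := fun t x =>
    (T.right_inv.iterate t : Function.LeftInverse _ _) x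
  constructor
  · rintro (h | h)
    · left
      by_contra h0
      exact hx.2.2 t (by omega) ht h
    · right
      simp only [mem_iUnion] at h
      obtain ⟨m, s, ⟨hs, hj⟩, h⟩ := h
      have h' : (⇑T.symm)^[s] ((⇑T)^[t] x) ∈ D m := h
      have hu := col_uniq hx (hD m h') ht hs (hri _ _).symm
      rw [← hu.2] at h'
      have hnm := ret_uniq (by omega) (by omega) hx (hD m h')
      subst hnm
      exact ⟨h', hu.1 ▸ hj⟩
  · rintro (h | ⟨h, hj⟩)
    · subst h; exact Or.inl hx.1
    · right
      simp only [mem_iUnion]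
      exact ⟨n, t, ⟨ht, hj⟩, by simpa [hli] using h⟩

theorem ret_step {B : Set X} {y : X} {r : ℕ} (hr : y ∈ retLevel T B r) (h1 : 1 ≤ r) {m : ℕ} (hm : 1 ≤ m) :
    y ∈ retLevel T B m ↔ m = r :=
  ⟨fun h => ret_uniq hm h1 h hr, fun h => h ▸ hr⟩

theorem ret_notD {A : Set X} {D : ℕ → Set X} (hD : ∀ n, D n ⊆ retLevel T A n) (j : ℕ → ℕ)
    {n t m : ℕ} (ht : t < n) (hm : 1 ≤ m) {x : X} (hx : x ∈ retLevel T A n) (hxD : x ∉ D n) :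
    (⇑T)^[t] x ∈ retLevel T (refSec T A D j) m ↔ t = 0 ∧ n = m := by
  by_cases h0 : t = 0
  · subst h0
    have : (⇑T)^[0] x ∈ retLevel T (refSec T A D j) n := by
      refine ⟨Or.inl hx.1, Or.inl hx.2.1, fun s hs hsn h => ?_⟩
      rcases (refSec_iff hD j hsn hx).1 h with h | h
      · omega
      · exact hxD h.1
    rw [ret_step this (by omega) hm]
    simp [eq_comm]
  · simp only [h0, false_and, iff_false]
    intro h
    rcases (refSec_iff hD j ht hx).1 h.1 with h | h
    · exact h0 h
    · exact hxD h.1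

theorem ret_D {A : Set X} {D : ℕ → Set X} (hD : ∀ n, D n ⊆ retLevel T A n) (j : ℕ → ℕ) (hj : ∀ n, 1 ≤ j n)
    {n t m : ℕ} (ht : t < n) (hm : 1 ≤ m) {x : X} (hxD : x ∈ D n) :
    (⇑T)^[t] x ∈ retLevel T (refSec T A D j) m ↔
      j n ∣ t ∧ ((t + j n ≤ n ∧ j n = m) ∨ (n < t + j n ∧ n - t = m)) := by
  have hx := hD n hxD
  have hjn := hj n
  by_cases h0 : j n ∣ t
  · simp only [h0, true_and]
    have hin : (⇑T)^[t] x ∈ refSec T A D j := (refSec_iff hD j ht hx).2 (Or.inr ⟨hxD, h0⟩)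
    have hbet : ∀ s, 1 ≤ s → s < j n → t + s < n → (⇑T)^[s] ((⇑T)^[t] x) ∉ refSec T A D j := by
      intro s h1 h2 h3 h4
      rw [← Function.iterate_add_apply, add_comm s t] at h4
      rcases (refSec_iff hD j h3 hx).1 h4 with h | h
      · omega
      · have := (Nat.dvd_add_right h0).1 h.2
        exact absurd (Nat.le_of_dvd (by omega) this) (by omega)
    have hend : (⇑T)^[n - t] ((⇑T)^[t] x) ∈ refSec T A D j := by
      rw [← Function.iterate_add_apply, Nat.sub_add_cancel ht.le]
      exact Or.inl hx.2.1
    by_cases hle : t + j n ≤ n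
    · have : (⇑T)^[t] x ∈ retLevel T (refSec T A D j) (j n) := by
        refine ⟨hin, ?_, fun s h1 h2 => hbet s h1 h2 (by omega)⟩
        rcases hle.eq_or_lt with h | h
        · rwa [show j n = n - t by omega]
        · rw [← Function.iterate_add_apply, add_comm]
          exact (refSec_iff hD j h hx).2 (Or.inr ⟨hxD, (Nat.dvd_add_right h0).2 dvd_rfl⟩)
      rw [ret_step this hjn hm]
      omega
    · have : (⇑T)^[t] x ∈ retLevel T (refSec T A D j) (n - t) :=
        ⟨hin, hend, fun s h1 h2 => hbet s h1 (by omega) (by omega)⟩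
      rw [ret_step this (by omega) hm]
      omega
  · simp only [h0, false_and, iff_false]
    intro h
    rcases (refSec_iff hD j ht hx).1 h.1 with h | h
    · subst h; exact h0 (dvd_zero _)
    · exact h0 h.2

theorem count_full (n j : ℕ) (hj : 1 ≤ j) :
    ((Finset.range n).filter (fun t => j ∣ t ∧ t + j ≤ n)).card = n / j := by
  have : (Finset.range n).filter (fun t => j ∣ t ∧ t + j ≤ n) = (Finset.range (n / j)).image (fun i => j * i) := by
    ext t
    simp only [Finset.mem_filter, Finset.mem_range, Finset.mem_image]
    constructor
    · rintro ⟨-, ⟨i, rfl⟩, h⟩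
      refine ⟨i, ?_, rfl⟩
      rw [← Nat.succ_le_iff, Nat.le_div_iff_mul_le (by omega)]
      rw [Nat.succ_mul, mul_comm]; exact h
    · rintro ⟨i, hi, rfl⟩
      rw [← Nat.succ_le_iff, Nat.le_div_iff_mul_le (by omega), Nat.succ_mul, mul_comm] at hi
      exact ⟨by omega, dvd_mul_right _ _, hi⟩
  rw [this, Finset.card_image_of_injective _ (fun x y h => Nat.eq_of_mul_eq_mul_left (show 0 < j by omega) h), Finset.card_range]

theorem count_rem (n j m : ℕ) (hj : 1 ≤ j) (hm : 1 ≤ m) :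
    ((Finset.range n).filter (fun t => j ∣ t ∧ n < t + j ∧ n - t = m)).card = if n % j = m then 1 else 0 := by
  have hdm := Nat.div_add_mod n j
  have hml := Nat.mod_lt n (show 0 < j by omega)
  have key : ∀ t, t < n → j ∣ t → n < t + j → n % j = n - t := by
    rintro t h1 ⟨i, rfl⟩ h2
    obtain ⟨k, hk⟩ := Nat.exists_eq_add_of_le h1.le
    have : k < j := by omega
    rw [hk, Nat.mul_add_mod, Nat.mod_eq_of_lt this]; omega
  split_ifs with h
  · rw [Finset.card_eq_one]
    refine ⟨j * (n / j), ?_⟩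
    ext t
    simp only [Finset.mem_filter, Finset.mem_range, Finset.mem_singleton]
    constructor
    · rintro ⟨h1, h2, h3, h4⟩
      have := key t h1 h2 h3
      omega
    · rintro rfl
      exact ⟨by omega, dvd_mul_right _ _, by omega, by omega⟩
  · rw [Finset.card_eq_zero, Finset.filter_eq_empty_iff]
    rintro t h1 ⟨h2, h3, h4⟩
    rw [Finset.mem_range] at h1
    exact h (by rw [key t h1 h2 h3, h4])

theorem count_all (n j : ℕ) (hj : 1 ≤ j) :
    ((Finset.range n).filter (fun t => t ≠ 0 ∧ j ∣ t)).card ≤ n / j := by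
  rw [← Nat.Ioc_filter_dvd_card_eq_div]
  refine Finset.card_le_card fun t => ?_
  simp only [Finset.mem_filter, Finset.mem_range, Finset.mem_Ioc]
  rintro ⟨h1, h2, h3⟩
  exact ⟨⟨by omega, by omega⟩, h3⟩

theorem col_sum {A : Set X} (hA : MeasurableSet A) {D : ℕ → Set X} (hDm : ∀ n, MeasurableSet (D n))
    (hD : ∀ n, D n ⊆ retLevel T A n) (j : ℕ → ℕ) (hj : ∀ n, 1 ≤ j n) (n : ℕ) (hn : 1 ≤ n) {m : ℕ} (hm : 1 ≤ m) :
    ∑ t ∈ Finset.range n, lam (retLevel T A n ∩ (⇑T)^[t] ⁻¹' (retLevel T (refSec T A D j) m)) =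
      ((if n = m then lam (retLevel T A n \ D n) else 0) + (if n % j n = m then lam (D n) else 0)) +
        (if j n = m then lam (D n) * ((n / j n : ℕ) : ℝ≥0∞) else 0) := by
  classical
  set R := retLevel T (refSec T A D j) m with hR
  have h1 : ∀ t ∈ Finset.range n, lam (retLevel T A n ∩ (⇑T)^[t] ⁻¹' R) =
      (if t = 0 then (if n = m then lam (retLevel T A n \ D n) else 0) else 0) +
      ((if j n ∣ t ∧ n < t + j n ∧ n - t = m then lam (D n) else 0) +
      (if j n ∣ t ∧ t + j n ≤ n then (if j n = m then lam (D n) else 0) else 0)) := by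
    intro t ht
    rw [Finset.mem_range] at ht
    rw [← measure_inter_add_diff _ (hDm n), add_comm]
    congr 1
    · by_cases hc : t = 0 ∧ n = m
      · rw [if_pos hc.1, if_pos hc.2]
        congr 1
        ext x
        constructor
        · rintro ⟨⟨a, b⟩, c⟩; exact ⟨a, c⟩
        · rintro ⟨a, c⟩; exact ⟨⟨a, (ret_notD hD j ht hm a c).2 hc⟩, c⟩
      · have : (retLevel T A n ∩ (⇑T)^[t] ⁻¹' R) \ D n = ∅ := by
          refine Set.eq_empty_of_forall_notMem ?_
          rintro x ⟨⟨a, b⟩, c⟩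
          exact hc ((ret_notD hD j ht hm a c).1 b)
        rw [this, measure_empty]
        split_ifs <;> simp_all
    · by_cases hc : j n ∣ t ∧ ((t + j n ≤ n ∧ j n = m) ∨ (n < t + j n ∧ n - t = m))
      · have : retLevel T A n ∩ (⇑T)^[t] ⁻¹' R ∩ D n = D n := by
          ext x
          constructor
          · exact fun h => h.2
          · exact fun h => ⟨⟨hD n h, (ret_D hD j hj ht hm h).2 hc⟩, h⟩
        rw [this]
        obtain ⟨c1, c2 | c2⟩ := hc
        · rw [if_neg (by omega), if_pos ⟨c1, c2.1⟩, if_pos c2.2, zero_add]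
        · rw [if_pos ⟨c1, c2⟩, if_neg (by omega), add_zero]
      · have : retLevel T A n ∩ (⇑T)^[t] ⁻¹' R ∩ D n = ∅ := by
          refine Set.eq_empty_of_forall_notMem ?_
          rintro x ⟨⟨a, b⟩, c⟩
          exact hc ((ret_D hD j hj ht hm c).1 b)
        rw [this, measure_empty]
        rw [if_neg (fun h => hc ⟨h.1, Or.inr h.2⟩)]
        split_ifs with h2 h3
        · exact absurd ⟨h2.1, Or.inl ⟨h2.2, h3⟩⟩ hc
        · simp
        · simp
  rw [Finset.sum_congr rfl h1, Finset.sum_add_distrib, Finset.sum_add_distrib, add_assoc]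
  congr 1
  · rw [Finset.sum_ite_eq' (Finset.range n) 0, if_pos (Finset.mem_range.2 hn)]
  congr 1
  · rw [← Finset.sum_filter, Finset.sum_const, count_rem n (j n) m (hj n) hm]
    split_ifs <;> simp
  · rw [← Finset.sum_filter, Finset.sum_const, count_full n (j n) (hj n)]
    split_ifs <;> simp [mul_comm]

theorem col_total {A : Set X} {D : ℕ → Set X}
    (hD : ∀ n, D n ⊆ retLevel T A n) (j : ℕ → ℕ) (hj : ∀ n, 1 ≤ j n) (n : ℕ) (hn : 1 ≤ n) :
    ∑ t ∈ Finset.range n, lam (retLevel T A n ∩ (⇑T)^[t] ⁻¹' (refSec T A D j)) ≤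
      lam (retLevel T A n) + lam (D n) * ((n / j n : ℕ) : ℝ≥0∞) := by
  classical
  calc ∑ t ∈ Finset.range n, lam (retLevel T A n ∩ (⇑T)^[t] ⁻¹' (refSec T A D j))
      ≤ ∑ t ∈ Finset.range n, ((if t = 0 then lam (retLevel T A n) else 0) +
        (if t ≠ 0 ∧ j n ∣ t then lam (D n) else 0)) := by
        refine Finset.sum_le_sum fun t ht => ?_
        rw [Finset.mem_range] at ht
        by_cases h0 : t = 0
        · rw [if_pos h0]
          exact (measure_mono inter_subset_left).trans le_self_add
        · rw [if_neg h0, zero_add]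
          by_cases hd : j n ∣ t
          · rw [if_pos ⟨h0, hd⟩]
            refine measure_mono ?_
            rintro x ⟨a, b⟩
            rcases (refSec_iff hD j ht a).1 b with h | h
            · exact absurd h h0
            · exact h.1
          · rw [if_neg (fun h => hd h.2)]
            have : retLevel T A n ∩ (⇑T)^[t] ⁻¹' (refSec T A D j) = ∅ := by
              refine Set.eq_empty_of_forall_notMem ?_
              rintro x ⟨a, b⟩
              rcases (refSec_iff hD j ht a).1 b with h | h
              · exact h0 h
              · exact hd h.2
            rw [this, measure_empty]
    _ ≤ _ := by
        rw [Finset.sum_add_distrib, Finset.sum_ite_eq' (Finset.range n) 0, if_pos (Finset.mem_range.2 hn)]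
        gcongr
        rw [← Finset.sum_filter, Finset.sum_const, nsmul_eq_mul, mul_comm]
        gcongr
        exact count_all n (j n) (hj n)

/-- column masses -/
noncomputable def colMass (lam : Measure X) (T : X ≃ᵐ X) (A : Set X) (n : ℕ) : NNReal :=
  if n = 0 then 0 else (lam (retLevel T A n)).toNNReal

theorem ret_ne_top {A : Set X} (hfin : lam A ≠ ∞) (n : ℕ) : lam (retLevel T A n) ≠ ∞ :=
  ne_top_of_le_ne_top hfin (measure_mono fun _ h => h.1)

theorem colMass_coe {A : Set X} (hfin : lam A ≠ ∞) {n : ℕ} (hn : n ≠ 0) :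
    (colMass lam T A n : ℝ≥0∞) = lam (retLevel T A n) := by
  rw [colMass, if_neg hn, ENNReal.coe_toNNReal (ret_ne_top hfin n)]

theorem colMass_sum (hc : Conserv lam T) {A : Set X} (hA : MeasurableSet A) (hfin : lam A ≠ ∞) :
    ∑' n, (colMass lam T A n : ℝ≥0∞) = lam A := by
  rw [measure_eq_ret hc hA, tsum_eq_zero_add' ENNReal.summable]
  simp only [colMass_coe hfin (Nat.succ_ne_zero _)]
  simp [colMass]

theorem colMass_inf (hT : MeasurePreserving (⇑T) lam lam) (hc : Conserv lam T) (hX : lam univ = ∞)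
    {A : Set X} (hA : MeasurableSet A) (hfin : lam A ≠ ∞)
    (hh : ∀ᵐ x ∂lam, ∃ n : ℕ, (⇑T)^[n] x ∈ A) :
    ∑' n : ℕ, (n : ℝ≥0∞) * colMass lam T A n = ∞ := by
  rw [← hX, decomp hT hc hA hh MeasurableSet.univ]
  congr 1; ext n
  rcases eq_or_ne n 0 with h | h
  · simp [h]
  · rw [colMass_coe hfin h]; simp

theorem exists_D [StandardBorelSpace X] [NullSingletonClass lam] {A : Set X} (hA : MeasurableSet A)
    (hfin : lam A ≠ ∞) (d : ℕ → NNReal) (hd : ∀ n, d n ≤ colMass lam T A n) :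
    ∃ D : ℕ → Set X, (∀ n, MeasurableSet (D n)) ∧ (∀ n, D n ⊆ retLevel T A n) ∧ ∀ n, lam (D n) = d n := by
  have : ∀ n, ∃ D : Set X, MeasurableSet D ∧ D ⊆ retLevel T A n ∧ lam D = d n := by
    intro n
    have hle : (d n : ℝ≥0∞) ≤ lam (retLevel T A n) := by
      rcases eq_or_ne n 0 with h | h
      · have := hd n
        simp only [colMass, h, if_true] at this
        have h2 : d n = 0 := by rw [h]; simpa using this
        simp [h2]
      · rw [← colMass_coe hfin h]; exact_mod_cast hd n
    obtain ⟨D, h1, h2, h3⟩ := exists_subset_measure lam _ (retLevel_meas hA n) (ret_ne_top hfin n) _ hle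
    exact ⟨D, h2, h1, h3⟩
  choose D h1 h2 h3 using this
  exact ⟨D, h1, h2, h3⟩

theorem ref_dist (hT : MeasurePreserving (⇑T) lam lam) (hc : Conserv lam T)
    {A : Set X} (hA : MeasurableSet A) (hfin : lam A ≠ ∞)
    (hh : ∀ᵐ x ∂lam, ∃ n : ℕ, (⇑T)^[n] x ∈ A) {d : ℕ → NNReal} {D : ℕ → Set X}
    (hDm : ∀ n, MeasurableSet (D n)) (hD : ∀ n, D n ⊆ retLevel T A n) (hd : ∀ n, lam (D n) = d n)
    (j : ℕ → ℕ) (hj : ∀ n, 1 ≤ j n) {m : ℕ} (hm : 1 ≤ m) :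
    lam (retLevel T (refSec T A D j) m) = emit (colMass lam T A) d j m + consu d j m := by
  rw [decomp hT hc hA hh (retLevel_meas (refSec_meas hA hDm j) m), emit, consu, ← ENNReal.tsum_add]
  congr 1; ext n
  rcases eq_or_ne n 0 with h | h
  · subst h
    have : ¬ (0 = m) := by omega
    simp [this]
  · rw [col_sum hA hDm hD j hj n (by omega) hm, hd, measure_diff (hD n) (hDm n).nullMeasurableSet (by rw [hd]; simp),
      hd, ENNReal.coe_sub, colMass_coe hfin h]

theorem ref_bound (hT : MeasurePreserving (⇑T) lam lam) (hc : Conserv lam T)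
    {A : Set X} (hA : MeasurableSet A) (hfin : lam A ≠ ∞)
    (hh : ∀ᵐ x ∂lam, ∃ n : ℕ, (⇑T)^[n] x ∈ A) {d : ℕ → NNReal} {D : ℕ → Set X}
    (hDm : ∀ n, MeasurableSet (D n)) (hD : ∀ n, D n ⊆ retLevel T A n) (hd : ∀ n, lam (D n) = d n)
    (j : ℕ → ℕ) (hj : ∀ n, 1 ≤ j n) :
    lam (refSec T A D j) ≤ lam A + ∑' n, (d n : ℝ≥0∞) * ((n / j n : ℕ) : ℝ≥0∞) := by
  rw [decomp hT hc hA hh (refSec_meas hA hDm j), ← colMass_sum hc hA hfin, ← ENNReal.tsum_add]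
  refine ENNReal.tsum_le_tsum fun n => ?_
  rcases eq_or_ne n 0 with h | h
  · subst h; simp
  · rw [colMass_coe hfin h, ← hd]
    exact col_total hD j hj n (by omega)

theorem ref_orbit {A : Set X} (hh : ∀ᵐ x ∂lam, ∃ n : ℕ, (⇑T)^[n] x ∈ A) (D : ℕ → Set X) (j : ℕ → ℕ) :
    ∀ᵐ x ∂lam, ∃ n : ℤ, ⇑(T.toEquiv ^ n) x ∈ refSec T A D j := by
  filter_upwards [hh] with x ⟨n, hn⟩
  refine ⟨n, Or.inl ?_⟩
  rw [zpow_natCast, Equiv.Perm.coe_pow]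
  exact hn

end Erg

theorem common_return_time_distribution
    [MeasurableSpace X] [StandardBorelSpace X]
    (lam : Measure X) [SigmaFinite lam] [NullSingletonClass lam] (hX : lam univ = ∞)
    (T₁ T₂ : X ≃ᵐ X)
    (hT₁ : MeasurePreserving (⇑T₁) lam lam) (hT₂ : MeasurePreserving (⇑T₂) lam lam)
    (hcons₁ : Conserv lam T₁) (hcons₂ : Conserv lam T₂)
    (hap₁ : Aperiodic lam T₁) (hap₂ : Aperiodic lam T₂) :
    ∀ ε : ℝ≥0∞, 0 < ε → ∃ B₁ B₂ : Set X, MeasurableSet B₁ ∧ MeasurableSet B₂ ∧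
      (∀ᵐ x ∂lam, ∃ n : ℤ, ⇑(T₁.toEquiv ^ n) x ∈ B₁) ∧
      (∀ᵐ x ∂lam, ∃ n : ℤ, ⇑(T₂.toEquiv ^ n) x ∈ B₂) ∧
      lam B₁ = lam B₂ ∧ lam B₁ < ε ∧
      ∀ n : ℕ, 1 ≤ n → lam (retLevel T₁ B₁ n) = lam (retLevel T₂ B₂ n) := by
  intro ε hε
  have hε2 : 0 < min ε 1 / 2 := ENNReal.half_pos (by simp [hε.ne'])
  have hlt : min ε 1 / 2 < ∞ := ENNReal.div_lt_top (by simp) (by simp)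
  obtain ⟨A₁, hA₁, hs₁, hh₁⟩ := small_section hT₁ hcons₁ hap₁ hε2
  obtain ⟨A₂, hA₂, hs₂, hh₂⟩ := small_section hT₂ hcons₂ hap₂ hε2
  have hf₁ : lam A₁ ≠ ∞ := (hs₁.trans hlt).ne
  have hf₂ : lam A₂ ≠ ∞ := (hs₂.trans hlt).ne
  obtain ⟨d, d', j, j', hd, hd', hj, hj', h1, h2⟩ := numeric (colMass lam T₁ A₁) (colMass lam T₂ A₂)
    (by rw [colMass_sum hcons₁ hA₁ hf₁]; exact hf₁) (colMass_inf hT₁ hcons₁ hX hA₁ hf₁ hh₁)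
    (by rw [colMass_sum hcons₂ hA₂ hf₂]; exact hf₂) (colMass_inf hT₂ hcons₂ hX hA₂ hf₂ hh₂)
  obtain ⟨D, hDm, hDs, hDd⟩ := exists_D hA₁ hf₁ d hd
  obtain ⟨D', hDm', hDs', hDd'⟩ := exists_D hA₂ hf₂ d' hd'
  have hret : ∀ n : ℕ, 1 ≤ n → lam (retLevel T₁ (refSec T₁ A₁ D j) n) =
      lam (retLevel T₂ (refSec T₂ A₂ D' j') n) := by
    intro n hn
    rw [ref_dist hT₁ hcons₁ hA₁ hf₁ hh₁ hDm hDs hDd j hj hn,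
      ref_dist hT₂ hcons₂ hA₂ hf₂ hh₂ hDm' hDs' hDd' j' hj' hn, h1 n hn, h2 n hn, add_comm]
  refine ⟨refSec T₁ A₁ D j, refSec T₂ A₂ D' j', refSec_meas hA₁ hDm j, refSec_meas hA₂ hDm' j',
    ref_orbit hh₁ D j, ref_orbit hh₂ D' j', ?_, ?_, hret⟩
  · rw [measure_eq_ret hcons₁ (refSec_meas hA₁ hDm j), measure_eq_ret hcons₂ (refSec_meas hA₂ hDm' j')]
    exact tsum_congr fun n => hret _ (by omega)
  · calc lam (refSec T₁ A₁ D j) ≤ lam A₁ + ∑' n, (d n : ℝ≥0∞) * ((n / j n : ℕ) : ℝ≥0∞) :=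
          ref_bound hT₁ hcons₁ hA₁ hf₁ hh₁ hDm hDs hDd j hj
      _ ≤ lam A₁ + lam A₂ := by
          gcongr
          rw [← colMass_sum hcons₂ hA₂ hf₂]
          exact cons_total _ _ _ hd' j j' hj h1
      _ < min ε 1 / 2 + min ε 1 / 2 := ENNReal.add_lt_add hs₁ hs₂
      _ = min ε 1 := ENNReal.add_halves _
      _ ≤ ε := min_le_left _ _
end

section
/- Let (X, λ) be a standard Borel space with an atomless σ-finite measure satisfying λ(X) = ∞. Let T₁ ∈ Aut(X, λ) with Hopf decomposition X = 𝔠₁ ⊔ 𝔡₁, and let D₁ ⊆ 𝔡₁ be a fundamental domain for the restriction of T₁ to 𝔡₁, with λ(D₁) = d₁. Let ε > 0 and let T₂ ∈ Aut(X, λ) satisfy λ({x ∈ X : T₁(x) ≠ T₂(x)}) ≤ ε. Then there exists a Borel set E ⊆ X with λ(E) ≥ d₁ − ε such that the sets T₂ⁿ(E), n ∈ ℤ, are pairwise disjoint (so the dissipative part of T₂ admits a fundamental domain of measure at least d₁ − ε). -/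
open MeasureTheory Set
open scoped ENNReal

variable {X : Type*}

/-- The restriction of `T` to `Y` is conservative. -/
def ConservativeOn [MeasurableSpace X] (lam : Measure X) (T : X ≃ᵐ X) (Y : Set X) : Prop :=
  ∀ A : Set X, A ⊆ Y → MeasurableSet A → 0 < lam A →
    ∀ᵐ x ∂lam, x ∈ A → ∃ n : ℕ, 1 ≤ n ∧ (⇑T)^[n] x ∈ A

/-- `D` is a fundamental domain for the restriction of `T` to the invariant set `Y`. -/
def IsFundDomOn [MeasurableSpace X] (lam : Measure X) (T : X ≃ᵐ X) (Y D : Set X) : Prop :=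
  D ⊆ Y ∧
  (Pairwise fun m n : ℤ => Disjoint (⇑(T.toEquiv ^ m) '' D) (⇑(T.toEquiv ^ n) '' D)) ∧
  lam (Y \ ⋃ n : ℤ, ⇑(T.toEquiv ^ n) '' D) = 0

theorem dissipative_fund_dom_measure_lower_bound
    [MeasurableSpace X] [StandardBorelSpace X]
    (lam : Measure X) [SigmaFinite lam] [NullSingletonClass lam] (hX : lam univ = ∞)
    (T₁ : X ≃ᵐ X) (hT₁ : MeasurePreserving (⇑T₁) lam lam)
    (c₁ d₁ D₁ : Set X)
    (hc₁ : MeasurableSet c₁) (hd₁ : MeasurableSet d₁) (hD₁ : MeasurableSet D₁)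
    (hdisj : Disjoint c₁ d₁) (hcover : c₁ ∪ d₁ = univ)
    (hinvc : ⇑T₁ '' c₁ = c₁) (hinvd : ⇑T₁ '' d₁ = d₁)
    (hcons : ConservativeOn lam T₁ c₁)
    (hfd : IsFundDomOn lam T₁ d₁ D₁)
    (d₁val : ℝ≥0∞) (hd₁val : lam D₁ = d₁val)
    (ε : ℝ≥0∞) (hε : 0 < ε)
    (T₂ : X ≃ᵐ X) (hT₂ : MeasurePreserving (⇑T₂) lam lam)
    (hclose : lam {x | T₁ x ≠ T₂ x} ≤ ε) :
    ∃ E : Set X, MeasurableSet E ∧ d₁val - ε ≤ lam E ∧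
      Pairwise fun m n : ℤ => Disjoint (⇑(T₂.toEquiv ^ m) '' E) (⇑(T₂.toEquiv ^ n) '' E) := by
  obtain ⟨-, hpw, -⟩ := hfd
  set N := toMeasurable lam {x | T₁ x ≠ T₂ x} with hN
  have hNm : MeasurableSet N := measurableSet_toMeasurable _ _
  have hNle : lam N ≤ ε := by rw [hN, measure_toMeasurable]; exact hclose
  have hNsub : ∀ x, x ∉ N → T₁ x = T₂ x := by
    intro x hx
    by_contra h
    exact hx (subset_toMeasurable _ _ h)
  have himg : ∀ (T : X ≃ᵐ X) (n : ℕ) (x : X), (T.toEquiv ^ (n : ℤ)) x = (⇑T)^[n] x := by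
    intro T n x
    rw [zpow_natCast, Equiv.Perm.coe_pow]
    rfl
  have hmp : ∀ n : ℕ, MeasurePreserving ((⇑T₁)^[n]) lam lam := fun n => hT₁.iterate n
  -- the part of the fundamental domain whose forward orbit meets the bad set
  let P : ℕ → Set X := fun n => (⇑T₁)^[n] ⁻¹' N ∩ D₁
  have hPm : ∀ n, MeasurableSet (P n) := fun n => ((hmp n).measurable hNm).inter hD₁
  let Q : ℕ → Set X := fun n => (⇑(T₁.symm))^[n] ⁻¹' (P n)
  have hQm : ∀ n, MeasurableSet (Q n) := fun n =>
    (T₁.symm.measurable.iterate n) (hPm n)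
  have hri : ∀ n : ℕ, Function.RightInverse ((⇑T₁.symm)^[n]) ((⇑T₁)^[n]) := fun n =>
    Function.RightInverse.iterate (fun x => T₁.apply_symm_apply x) n
  have hli : ∀ n : ℕ, Function.LeftInverse ((⇑T₁.symm)^[n]) ((⇑T₁)^[n]) := fun n =>
    Function.LeftInverse.iterate (fun x => T₁.symm_apply_apply x) n
  have hPQ : ∀ n, lam (P n) = lam (Q n) := by
    intro n
    rw [← (hmp n).measure_preimage (hQm n).nullMeasurableSet]
    congr 1
    ext x
    change x ∈ P n ↔ (⇑T₁.symm)^[n] ((⇑T₁)^[n] x) ∈ P n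
    rw [hli n x]
  have hQN : ∀ n, Q n ⊆ N := by
    intro n y hy
    have h := hy.1
    change (⇑T₁)^[n] ((⇑T₁.symm)^[n] y) ∈ N at h
    rwa [hri n y] at h
  have hQD : ∀ n : ℕ, Q n ⊆ ⇑(T₁.toEquiv ^ (n : ℤ)) '' D₁ := by
    intro n y hy
    exact ⟨_, hy.2, by rw [himg, hri n y]⟩
  have hQd : Pairwise fun m n => Disjoint (Q m) (Q n) := by
    intro m n hmn
    exact (hpw (by exact_mod_cast hmn : (m : ℤ) ≠ n)).mono (hQD m) (hQD n)
  have hB : lam (⋃ n, P n) ≤ ε := by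
    calc lam (⋃ n, P n) ≤ ∑' n, lam (P n) := measure_iUnion_le _
      _ = ∑' n, lam (Q n) := by simp only [hPQ]
      _ = lam (⋃ n, Q n) := (measure_iUnion hQd hQm).symm
      _ ≤ lam N := measure_mono (iUnion_subset hQN)
      _ ≤ ε := hNle
  have horb : ∀ x ∈ D₁ \ ⋃ n, P n, ∀ n : ℕ, (⇑T₂)^[n] x = (⇑T₁)^[n] x := by
    intro x hx n
    induction n with
    | zero => rfl
    | succ k ih =>
      rw [Function.iterate_succ_apply', Function.iterate_succ_apply', ih]
      refine (hNsub _ fun h => hx.2 (mem_iUnion.2 ⟨k, h, hx.1⟩)).symm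
  refine ⟨D₁ \ ⋃ n, P n, hD₁.diff (MeasurableSet.iUnion hPm), ?_, ?_⟩
  · rw [← hd₁val]
    exact (tsub_le_tsub_left hB _).trans le_measure_diff
  · have key : ∀ m n : ℤ, m < n → Disjoint (⇑(T₂.toEquiv ^ m) '' (D₁ \ ⋃ n, P n))
        (⇑(T₂.toEquiv ^ n) '' (D₁ \ ⋃ n, P n)) := by
      intro m n hmn
      obtain ⟨k, hk⟩ := Int.le.dest hmn.le
      have hk0 : (0 : ℤ) ≠ k := by omega
      rw [Set.disjoint_left]
      rintro _ ⟨x, hx, rfl⟩ ⟨y, hy, hxy⟩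
      rw [← hk, zpow_add, Equiv.Perm.mul_apply] at hxy
      have hxy' := (T₂.toEquiv ^ m).injective hxy
      rw [himg, horb y hy, ← himg] at hxy'
      exact Set.disjoint_left.1 (hpw hk0) ⟨x, hx.1, by simp⟩ ⟨y, hy.1, hxy'⟩
    intro m n hmn
    rcases lt_or_gt_of_ne hmn with h | h
    · exact key m n h
    · exact (key n m h).symm
end
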